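/- arXiv:1512.05442 — 2 statements merged into one kernel-verified Lean document; each statement's English description precedes it below -/
import Mathlib

section
/- Let K be an n-polytope in ℝ^n with facet outer unit normals u_1,…,u_N, and for t ∈ ℝ let K_t be the polytope obtained from K by moving its N-th facet by t, i.e. replacing the defining inequality ⟨x,u_N⟩ ≤ h_K(u_N) by ⟨x,u_N⟩ ≤ h_K(u_N)+t. Then there exists δ = δ(K) > 0 such that for every 0 ≤ r ≤ n−1 and every t ∈ (−δ,δ), the support of the mixed area measure S(K_t[r],K[n−1−r],·) equals the support of the surface area measure S(K,·). -/
open Pointwise MeasureTheory RealInnerProductSpace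

/-- The mixed volume of an `n`-tuple of sets in `ℝⁿ`, via the polarization formula. -/
noncomputable def mixedVol (n : ℕ) (K : Fin n → Set (EuclideanSpace ℝ (Fin n))) : ℝ :=
  ((n.factorial : ℝ))⁻¹ *
    ∑ S : Finset (Fin n), (-1 : ℝ) ^ (n - S.card) * (volume (∑ i ∈ S, K i)).toReal

/-- A convex body: a nonempty compact convex set. -/
def IsConvexBody {n : ℕ} (K : Set (EuclideanSpace ℝ (Fin n))) : Prop :=
  Convex ℝ K ∧ IsCompact K ∧ K.Nonempty

/-- The support function `h_K(u) = sup {⟨x,u⟩ : x ∈ K}`. -/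
noncomputable def suppFn {n : ℕ} (K : Set (EuclideanSpace ℝ (Fin n)))
    (u : EuclideanSpace ℝ (Fin n)) : ℝ :=
  sSup ((fun x => ⟪x, u⟫) '' K)

/-- The polytope obtained from `K` (given by facet normals `u j` and support numbers
`h_K(u j)`) by moving the `i`-th facet by `t`. -/
noncomputable def movedPoly {n N : ℕ} (K : Set (EuclideanSpace ℝ (Fin n)))
    (u : Fin N → EuclideanSpace ℝ (Fin n)) (i : Fin N) (t : ℝ) :
    Set (EuclideanSpace ℝ (Fin n)) :=
  {x | ∀ j : Fin N, ⟪x, u j⟫ ≤ suppFn K (u j) + if j = i then t else 0}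

/-- The support of a measure: points all of whose open neighborhoods have nonzero measure. -/
def msupport {α : Type*} [TopologicalSpace α] [MeasurableSpace α] (μ : Measure α) : Set α :=
  {x | ∀ U : Set α, IsOpen U → x ∈ U → μ U ≠ 0}

/-- A measure `μ` on the unit sphere is the mixed area measure
`S(Kt[r],K[n-1-r],·)` if `V(L,Kt[r],K[n-1-r]) = (1/n) ∫ h_L dμ` for every convex body `L`. -/
def IsMixedAreaMeasure (n : ℕ) (r : ℕ) (Kt K : Set (EuclideanSpace ℝ (Fin n)))
    (μ : Measure (Metric.sphere (0 : EuclideanSpace ℝ (Fin n)) 1)) : Prop :=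
  ∀ L : Set (EuclideanSpace ℝ (Fin n)), IsConvexBody L →
    mixedVol n (fun j : Fin n => if (j : ℕ) = 0 then L else if (j : ℕ) ≤ r then Kt else K)
      = (1 / n) * ∫ w : Metric.sphere (0 : EuclideanSpace ℝ (Fin n)) 1,
          suppFn L (w : EuclideanSpace ℝ (Fin n)) ∂μ

namespace MovedFacet

open Filter Topology Set Metric

/-! ### Support functions -/

section SupportFunction

variable {n : ℕ} {K L : Set (EuclideanSpace ℝ (Fin n))}

lemma bddAbove_inner_image (hK : IsCompact K) (u : EuclideanSpace ℝ (Fin n)) :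
    BddAbove ((fun x => ⟪x, u⟫) '' K) :=
  (hK.image (by fun_prop)).bddAbove

lemma inner_le_suppFn (hK : IsCompact K) (u : EuclideanSpace ℝ (Fin n))
    {x : EuclideanSpace ℝ (Fin n)} (hx : x ∈ K) : ⟪x, u⟫ ≤ suppFn K u :=
  le_csSup (bddAbove_inner_image hK u) ⟨x, hx, rfl⟩

lemma exists_inner_eq_suppFn (hK : IsCompact K) (hne : K.Nonempty)
    (u : EuclideanSpace ℝ (Fin n)) : ∃ x ∈ K, ⟪x, u⟫ = suppFn K u := by
  obtain ⟨x, hx, h⟩ := (hK.image (f := fun x => ⟪x, u⟫) (by fun_prop)).sSup_mem (hne.image _)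
  exact ⟨x, hx, h⟩

lemma suppFn_le (hne : K.Nonempty) {u : EuclideanSpace ℝ (Fin n)} {c : ℝ}
    (h : ∀ x ∈ K, ⟪x, u⟫ ≤ c) : suppFn K u ≤ c := by
  refine csSup_le (hne.image _) ?_
  rintro _ ⟨x, hx, rfl⟩
  exact h x hx

lemma suppFn_smul_set {s : ℝ} (hs : 0 ≤ s) (u : EuclideanSpace ℝ (Fin n)) :
    suppFn (s • K) u = s * suppFn K u := by
  have h : (fun x => ⟪x, u⟫) '' (s • K) = s • ((fun x => ⟪x, u⟫) '' K) := by
    ext y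
    simp only [mem_image, mem_smul_set]
    constructor
    · rintro ⟨_, ⟨x, hx, rfl⟩, rfl⟩
      exact ⟨_, ⟨x, hx, rfl⟩, by simp [real_inner_smul_left]⟩
    · rintro ⟨_, ⟨x, hx, rfl⟩, rfl⟩
      exact ⟨_, ⟨x, hx, rfl⟩, by simp [real_inner_smul_left]⟩
  rw [suppFn, h, Real.sSup_smul_of_nonneg hs, smul_eq_mul, suppFn]

lemma suppFn_zero (u : EuclideanSpace ℝ (Fin n)) :
    suppFn ({0} : Set (EuclideanSpace ℝ (Fin n))) u = 0 := by
  simp [suppFn]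

lemma suppFn_nonneg (hK : IsCompact K) (h0 : (0 : EuclideanSpace ℝ (Fin n)) ∈ K)
    (u : EuclideanSpace ℝ (Fin n)) : 0 ≤ suppFn K u := by
  simpa using inner_le_suppFn hK u h0

lemma suppFn_closedBall {u : EuclideanSpace ℝ (Fin n)} (hu : ‖u‖ = 1) :
    suppFn (closedBall (0 : EuclideanSpace ℝ (Fin n)) 1) u = 1 := by
  refine le_antisymm (suppFn_le ⟨0, by simp⟩ fun x hx => ?_) ?_
  · have := real_inner_le_norm x u
    simp_all
    linarith
  · have := inner_le_suppFn (isCompact_closedBall (0 : EuclideanSpace ℝ (Fin n)) 1) u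
      (x := u) (by simp [hu])
    simpa [real_inner_self_eq_norm_sq, hu] using this

lemma IsConvexBody.smul {s : ℝ} (hL : IsConvexBody L) : IsConvexBody (s • L) :=
  ⟨hL.1.smul s, hL.2.1.smul s, hL.2.2.smul_set⟩

lemma IsConvexBody.singleton_zero :
    IsConvexBody ({0} : Set (EuclideanSpace ℝ (Fin n))) :=
  ⟨convex_singleton 0, isCompact_singleton, singleton_nonempty 0⟩

end SupportFunction

/-! ### Shells over faces -/

/-- The points lying above the part of `M` on the hyperplane `⟪x, u⟫ = m`, at height in
`(0, τ]` in the direction `u`. -/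
def shell {n : ℕ} (M : Set (EuclideanSpace ℝ (Fin n))) (u : EuclideanSpace ℝ (Fin n))
    (m τ : ℝ) : Set (EuclideanSpace ℝ (Fin n)) :=
  {x | m < ⟪x, u⟫ ∧ ⟪x, u⟫ ≤ m + τ ∧ x - (⟪x, u⟫ - m) • u ∈ M}

section Shell

variable {n : ℕ} {M : Set (EuclideanSpace ℝ (Fin n))} {u : EuclideanSpace ℝ (Fin n)}

lemma measurableSet_shell (hM : IsClosed M) (m τ : ℝ) : MeasurableSet (shell M u m τ) := by
  have hc : Continuous fun x : EuclideanSpace ℝ (Fin n) => ⟪x, u⟫ := by fun_prop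
  exact (isOpen_lt continuous_const hc).measurableSet.inter
    ((isClosed_le hc continuous_const).measurableSet.inter
      (hM.preimage (f := fun x : EuclideanSpace ℝ (Fin n) => x - (⟪x, u⟫ - m) • u)
        (by fun_prop)).measurableSet)

lemma isBounded_cylinder (hM : Bornology.IsBounded M) (m : ℝ) {S : Set ℝ}
    (hS : Bornology.IsBounded S) :
    Bornology.IsBounded {x : EuclideanSpace ℝ (Fin n) | ⟪x, u⟫ - m ∈ S ∧
      x - (⟪x, u⟫ - m) • u ∈ M} := by
  obtain ⟨R, hR⟩ := hM.exists_norm_le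
  obtain ⟨A, hA⟩ := hS.exists_norm_le
  refine (Metric.isBounded_closedBall (x := (0 : EuclideanSpace ℝ (Fin n)))
    (r := R + A * ‖u‖)).subset ?_
  rintro x ⟨hx, hx'⟩
  rw [mem_closedBall_zero_iff]
  calc ‖x‖ = ‖(x - (⟪x, u⟫ - m) • u) + (⟪x, u⟫ - m) • u‖ := by simp
    _ ≤ ‖x - (⟪x, u⟫ - m) • u‖ + ‖(⟪x, u⟫ - m) • u‖ := norm_add_le _ _
    _ ≤ R + A * ‖u‖ := by
      rw [norm_smul]
      gcongr
      · exact hR _ hx'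
      · exact hA _ hx

lemma volume_shell_lt_top (hM : Bornology.IsBounded M) (m τ : ℝ) :
    volume (shell M u m τ) < ⊤ := by
  refine ((isBounded_cylinder (u := u) hM m (Metric.isBounded_Icc 0 τ)).subset
    ?_).measure_lt_top
  rintro x ⟨h1, h2, h3⟩
  exact ⟨⟨by linarith, by linarith⟩, h3⟩

lemma volume_shell (hM : IsClosed M) (hMb : Bornology.IsBounded M) (hu : ‖u‖ = 1) (m τ : ℝ) :
    volume (shell M u m τ) = ENNReal.ofReal τ * volume (shell M u m 1) := by
  set f : EuclideanSpace ℝ (Fin n) → ℝ := fun x => ⟪x, u⟫ - m with hf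
  set C : Set (EuclideanSpace ℝ (Fin n)) := {x | x - f x • u ∈ M} with hC
  have hfc : Continuous f := by fun_prop
  have hCm : MeasurableSet C := (hM.preimage (f := fun x => x - f x • u) (by fun_prop)).measurableSet
  set ν : Measure ℝ := (volume.restrict C).map f with hν
  have huu : ⟪u, u⟫ = (1 : ℝ) := by rw [real_inner_self_eq_norm_sq, hu]; norm_num
  have hν_apply : ∀ S : Set ℝ, MeasurableSet S → ν S = volume (f ⁻¹' S ∩ C) := fun S hS => by
    rw [hν, Measure.map_apply hfc.measurable hS, Measure.restrict_apply (hfc.measurable hS)]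
  have hinv : ν.IsAddLeftInvariant := by
    refine ⟨fun g => ?_⟩
    ext S hS
    rw [Measure.map_apply (measurable_const_add g) hS,
      hν_apply _ (measurable_const_add g hS), hν_apply _ hS,
      ← measure_preimage_add volume (g • u) (f ⁻¹' S ∩ C)]
    congr 1
    have key : ∀ x, f (g • u + x) = g + f x := fun x => by
      simp only [hf, inner_add_left, real_inner_smul_left, huu]; ring
    ext x
    have h2 : g • u + x - (g + f x) • u = x - f x • u := by rw [add_smul]; abel
    simp only [mem_inter_iff, mem_preimage, hC, mem_ofPred_eq, key, h2]
  have hfin : IsFiniteMeasureOnCompacts ν := by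
    refine ⟨fun S hS => ?_⟩
    rw [hν_apply _ hS.isClosed.measurableSet]
    exact (isBounded_cylinder hMb m hS.isBounded).measure_lt_top
  have hsh : ∀ τ, shell M u m τ = f ⁻¹' (Ioc 0 τ) ∩ C := by
    intro τ
    ext x
    simp only [shell, hf, hC, mem_ofPred_eq, mem_inter_iff, mem_preimage, mem_Ioc, sub_pos,
      and_assoc, sub_le_iff_le_add']
  have hlin : ∀ τ, volume (shell M u m τ) = ν (Ioc 0 τ) := fun τ => by
    rw [hsh, hν_apply _ measurableSet_Ioc]
  rw [hlin, hlin, Measure.isAddLeftInvariant_eq_smul ν volume]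
  simp only [Measure.smul_apply, Real.volume_Ioc, sub_zero, ENNReal.smul_def, smul_eq_mul,
    ENNReal.ofReal_one, mul_one]
  rw [mul_comm]

end Shell

/-! ### Volume of the intersection of two thin slabs -/

lemma volume_two_slabs_le {n : ℕ} {u v : EuclideanSpace ℝ (Fin n)} (hu : ‖u‖ = 1) (hv : ‖v‖ = 1)
    (huv : |⟪u, v⟫| < 1) {R C : ℝ} (hC : 0 < C) (a b : ℝ) :
    ∃ A : ℝ, ∀ s : ℝ, 0 < s → s ≤ 1 →
      volume.real {x : EuclideanSpace ℝ (Fin n) |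
        ‖x‖ ≤ R ∧ |⟪x, u⟫ - a| ≤ C * s ∧ |⟪x, v⟫ - b| ≤ C * s} ≤ A * s ^ 2 := by
  set c : ℝ := ⟪u, v⟫ with hc
  have huu : ⟪u, u⟫ = (1 : ℝ) := by rw [real_inner_self_eq_norm_sq, hu]; norm_num
  have hvv : ⟪v, v⟫ = (1 : ℝ) := by rw [real_inner_self_eq_norm_sq, hv]; norm_num
  have hvu : ⟪v, u⟫ = c := by rw [hc, real_inner_comm]
  have hd : 1 - c ^ 2 ≠ 0 := by
    have : c ^ 2 < 1 := by rwa [sq_lt_one_iff_abs_lt_one]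
    linarith
  set p : EuclideanSpace ℝ (Fin n) := (1 - c ^ 2)⁻¹ • (u - c • v) with hp
  set q : EuclideanSpace ℝ (Fin n) := (1 - c ^ 2)⁻¹ • (v - c • u) with hq
  have hpu : ⟪p, u⟫ = (1 : ℝ) := by
    rw [hp, real_inner_smul_left, inner_sub_left, real_inner_smul_left, huu, hvu]; field_simp
  have hpv : ⟪p, v⟫ = (0 : ℝ) := by
    rw [hp, real_inner_smul_left, inner_sub_left, real_inner_smul_left, hvv, ← hc]; simp
  have hqv : ⟪q, v⟫ = (1 : ℝ) := by
    rw [hq, real_inner_smul_left, inner_sub_left, real_inner_smul_left, hvv, ← hc]; field_simp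
  have hqu : ⟪q, u⟫ = (0 : ℝ) := by
    rw [hq, real_inner_smul_left, inner_sub_left, real_inner_smul_left, huu, hvu]; simp
  set B : Set (EuclideanSpace ℝ (Fin n)) := closedBall 0 (R + 3 * C * (‖p‖ + ‖q‖)) with hB
  refine ⟨4 * volume.real B, fun s hs hs1 => ?_⟩
  set W : Set (EuclideanSpace ℝ (Fin n)) :=
    {x | ‖x‖ ≤ R ∧ |⟪x, u⟫ - a| ≤ C * s ∧ |⟪x, v⟫ - b| ≤ C * s} with hW
  have hWm : MeasurableSet W := by
    have h1 : Continuous fun x : EuclideanSpace ℝ (Fin n) => |⟪x, u⟫ - a| := by fun_prop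
    have h2 : Continuous fun x : EuclideanSpace ℝ (Fin n) => |⟪x, v⟫ - b| := by fun_prop
    exact (isClosed_le continuous_norm continuous_const).measurableSet.inter
      ((isClosed_le h1 continuous_const).measurableSet.inter
        (isClosed_le h2 continuous_const).measurableSet)
  set m : ℕ := ⌊1 / s⌋₊ with hm
  have hs1' : 1 ≤ 1 / s := by rw [le_div_iff₀ hs]; linarith
  have hm_le : (m : ℝ) * s ≤ 1 := by
    have := Nat.floor_le (show 0 ≤ 1 / s by positivity)
    rwa [le_div_iff₀ hs] at this
  have hm_ge : 1 ≤ 2 * (m * s) := by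
    have h1 : 1 / s < m + 1 := Nat.lt_floor_add_one _
    have h2 : (1 : ℝ) ≤ m := by
      have : 1 ≤ m := Nat.le_floor (by simpa using hs1')
      exact_mod_cast this
    rw [div_lt_iff₀ hs] at h1
    nlinarith
  let sh : Fin m × Fin m → EuclideanSpace ℝ (Fin n) := fun i =>
    (3 * C * s) • (((i.1 : ℕ) : ℝ) • p + ((i.2 : ℕ) : ℝ) • q)
  have hshu : ∀ i x, ⟪sh i + x, u⟫ = 3 * C * s * (i.1 : ℕ) + ⟪x, u⟫ := fun i x => by
    simp only [sh, inner_add_left, real_inner_smul_left, hpu, hqu]; ring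
  have hshv : ∀ i x, ⟪sh i + x, v⟫ = 3 * C * s * (i.2 : ℕ) + ⟪x, v⟫ := fun i x => by
    simp only [sh, inner_add_left, real_inner_smul_left, hpv, hqv]; ring
  have hsep : ∀ (k l : ℕ) (y d : ℝ), |3 * C * s * k + y - d| ≤ C * s →
      |3 * C * s * l + y - d| ≤ C * s → k ≤ l := by
    intro k l y d h1 h2
    by_contra! h
    have h' : (l : ℝ) + 1 ≤ k := by exact_mod_cast h
    rw [abs_le] at h1 h2
    have h3 : 0 < C * s := by positivity
    nlinarith
  have hdisj : Set.PairwiseDisjoint (↑(Finset.univ : Finset (Fin m × Fin m)))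
      (fun i => (fun x => sh i + x) ⁻¹' W) := by
    intro i _ j _ hij
    refine Set.disjoint_left.2 fun x hx hx' => hij ?_
    simp only [hW, mem_preimage, mem_ofPred_eq, hshu, hshv] at hx hx'
    refine Prod.ext (Fin.ext (le_antisymm ?_ ?_)) (Fin.ext (le_antisymm ?_ ?_))
    · exact hsep _ _ _ _ hx.2.1 hx'.2.1
    · exact hsep _ _ _ _ hx'.2.1 hx.2.1
    · exact hsep _ _ _ _ hx.2.2 hx'.2.2
    · exact hsep _ _ _ _ hx'.2.2 hx.2.2
  have hsub : (⋃ i ∈ (Finset.univ : Finset (Fin m × Fin m)), (fun x => sh i + x) ⁻¹' W) ⊆ B := by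
    refine iUnion₂_subset fun i _ x hx => ?_
    rw [hB, mem_closedBall_zero_iff]
    have hbd : ∀ k : Fin m, s * ((k : ℕ) : ℝ) ≤ 1 := fun k => by
      have : ((k : ℕ) : ℝ) ≤ m := by exact_mod_cast k.2.le
      nlinarith
    have h1 : ‖sh i‖ ≤ 3 * C * (‖p‖ + ‖q‖) := by
      calc ‖sh i‖ = 3 * C * s * ‖((i.1 : ℕ) : ℝ) • p + ((i.2 : ℕ) : ℝ) • q‖ := by
            simp only [sh]
            rw [norm_smul, Real.norm_of_nonneg (by positivity)]
        _ ≤ 3 * C * s * (((i.1 : ℕ) : ℝ) * ‖p‖ + ((i.2 : ℕ) : ℝ) * ‖q‖) := by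
            gcongr
            refine (norm_add_le _ _).trans ?_
            simp [norm_smul]
        _ = 3 * C * ((s * ((i.1 : ℕ) : ℝ)) * ‖p‖ + (s * ((i.2 : ℕ) : ℝ)) * ‖q‖) := by ring
        _ ≤ 3 * C * (1 * ‖p‖ + 1 * ‖q‖) := by
            gcongr
            · exact hbd _
            · exact hbd _
        _ = _ := by ring
    have h2 : ‖sh i + x‖ ≤ R := hx.1
    calc ‖x‖ = ‖(sh i + x) - sh i‖ := by simp
      _ ≤ ‖sh i + x‖ + ‖sh i‖ := norm_sub_le _ _
      _ ≤ _ := by linarith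
  have hcount : (m : ℝ) ^ 2 * volume.real W ≤ volume.real B := by
    have h1 : volume.real (⋃ i ∈ (Finset.univ : Finset (Fin m × Fin m)),
        (fun x => sh i + x) ⁻¹' W) = (m : ℝ) ^ 2 * volume.real W := by
      rw [measureReal_biUnion_finset hdisj (fun i _ => measurable_const_add _ hWm)
        (fun i _ => ?_)]
      · simp only [Measure.real, measure_preimage_add]
        simp [sq]
      · rw [measure_preimage_add]
        exact (Metric.isBounded_closedBall.subset
          (fun x hx => mem_closedBall_zero_iff.2 hx.1)).measure_lt_top.ne
    rw [← h1]
    exact measureReal_mono hsub (Metric.isBounded_closedBall.measure_lt_top.ne)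
  have h0 : 0 ≤ volume.real W := measureReal_nonneg
  have hms : 1 ≤ 4 * ((m : ℝ) ^ 2 * s ^ 2) := by nlinarith
  calc volume.real W ≤ 4 * ((m : ℝ) ^ 2 * s ^ 2) * volume.real W := le_mul_of_one_le_left h0 hms
    _ = 4 * s ^ 2 * ((m : ℝ) ^ 2 * volume.real W) := by ring
    _ ≤ 4 * s ^ 2 * volume.real B := by gcongr
    _ = _ := by ring

/-! ### First variation of the volume of a polytope -/

section FirstVariation

variable {n N : ℕ}

/-- The points of the ball of radius `R` that are `η`-close to two of the hyperplanes
`⟪x, u j⟫ = m j`. -/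
def nearPairs (u : Fin N → EuclideanSpace ℝ (Fin n)) (m : Fin N → ℝ) (R η : ℝ) :
    Set (EuclideanSpace ℝ (Fin n)) :=
  ⋃ p : {p : Fin N × Fin N // p.1 ≠ p.2},
    {x | ‖x‖ ≤ R ∧ |⟪x, u p.1.1⟫ - m p.1.1| ≤ η ∧ |⟪x, u p.1.2⟫ - m p.1.2| ≤ η}

lemma measurableSet_nearPairs (u : Fin N → EuclideanSpace ℝ (Fin n)) (m : Fin N → ℝ) (R η : ℝ) :
    MeasurableSet (nearPairs u m R η) := by
  refine MeasurableSet.iUnion fun p => ?_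
  have h : ∀ k, Continuous fun x : EuclideanSpace ℝ (Fin n) => |⟪x, u k⟫ - m k| :=
    fun k => by fun_prop
  exact (isClosed_le continuous_norm continuous_const).measurableSet.inter
    ((isClosed_le (h _) continuous_const).measurableSet.inter
      (isClosed_le (h _) continuous_const).measurableSet)

lemma volume_nearPairs_ne_top (u : Fin N → EuclideanSpace ℝ (Fin n)) (m : Fin N → ℝ) (R η : ℝ) :
    volume (nearPairs u m R η) ≠ ⊤ := by
  refine (Metric.isBounded_closedBall (x := (0 : EuclideanSpace ℝ (Fin n)))
    (r := R)).subset ?_ |>.measure_lt_top.ne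
  refine iUnion_subset fun p x hx => ?_
  exact mem_closedBall_zero_iff.2 hx.1

lemma tendsto_volume_nearPairs {u : Fin N → EuclideanSpace ℝ (Fin n)} (hu : ∀ k, ‖u k‖ = 1)
    (huinj : Function.Injective u) {m : Fin N → ℝ} {z : EuclideanSpace ℝ (Fin n)}
    (hz : ∀ k, ⟪z, u k⟫ < m k) (R : ℝ) {C : ℝ} (hC : 0 < C) :
    Tendsto (fun s : ℝ => volume.real (nearPairs u m R (C * s)) / s) (𝓝[>] 0) (𝓝 0) := by
  have hpair : ∀ p : {p : Fin N × Fin N // p.1 ≠ p.2}, ∃ A : ℝ, ∀ᶠ s : ℝ in 𝓝[>] 0,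
      volume.real {x : EuclideanSpace ℝ (Fin n) | ‖x‖ ≤ R ∧
        |⟪x, u p.1.1⟫ - m p.1.1| ≤ C * s ∧ |⟪x, u p.1.2⟫ - m p.1.2| ≤ C * s} ≤ A * s ^ 2 := by
    rintro ⟨⟨j, k⟩, hjk⟩
    simp only at hjk ⊢
    by_cases hlt : |⟪u j, u k⟫| < 1
    · obtain ⟨A, hA⟩ := volume_two_slabs_le (R := R) (hu j) (hu k) hlt hC (m j) (m k)
      refine ⟨A, ?_⟩
      filter_upwards [Ioc_mem_nhdsGT (show (0 : ℝ) < 1 by norm_num)] with s hs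
      exact hA s hs.1 hs.2
    · have hle : |⟪u j, u k⟫| ≤ 1 := by
        simpa [hu] using abs_real_inner_le_norm (u j) (u k)
      have heq : |⟪u j, u k⟫| = 1 := le_antisymm hle (not_lt.1 hlt)
      have hopp : u j = - u k := by
        rcases (abs_eq zero_le_one).1 heq with h | h
        · exact absurd (huinj ((inner_eq_one_iff_of_norm_eq_one (hu j) (hu k)).1 h)) hjk
        · exact (inner_eq_neg_one_iff_of_norm_eq_one (hu j) (hu k)).1 h
      refine ⟨0, ?_⟩
      have hgap : 0 < m j + m k := by
        have h1 := hz j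
        have h2 := hz k
        rw [hopp, inner_neg_right] at h1
        linarith
      have hlim : Tendsto (fun s : ℝ => 2 * (C * s)) (𝓝[>] 0) (𝓝 0) := by
        have : Tendsto (fun s : ℝ => 2 * (C * s)) (𝓝 0) (𝓝 (2 * (C * 0))) :=
          (by fun_prop : Continuous fun s : ℝ => 2 * (C * s)).tendsto 0
        rw [mul_zero, mul_zero] at this
        exact this.mono_left nhdsWithin_le_nhds
      filter_upwards [hlim.eventually_lt_const hgap] with s hs
      have : {x : EuclideanSpace ℝ (Fin n) | ‖x‖ ≤ R ∧
          |⟪x, u j⟫ - m j| ≤ C * s ∧ |⟪x, u k⟫ - m k| ≤ C * s} = ∅ := by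
        refine eq_empty_of_forall_notMem fun x hx => ?_
        have h1 := (abs_le.1 hx.2.1).1
        have h2 := (abs_le.1 hx.2.2).1
        rw [hopp, inner_neg_right] at h1
        linarith
      rw [this]
      simp
  choose A hA using hpair
  have hall : ∀ᶠ s : ℝ in 𝓝[>] 0,
      volume.real (nearPairs u m R (C * s)) ≤ (∑ p, A p) * s ^ 2 := by
    filter_upwards [eventually_all.2 hA] with s hs
    refine (measureReal_iUnion_fintype_le _).trans ?_
    rw [Finset.sum_mul]
    exact Finset.sum_le_sum fun p _ => hs p
  have hlim : Tendsto (fun s : ℝ => (∑ p, A p) * s) (𝓝[>] 0) (𝓝 0) := by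
    have : Tendsto (fun s : ℝ => (∑ p, A p) * s) (𝓝 0) (𝓝 ((∑ p, A p) * 0)) :=
      (continuous_const.mul continuous_id).tendsto 0
    rw [mul_zero] at this
    exact this.mono_left nhdsWithin_le_nhds
  refine squeeze_zero' ?_ ?_ hlim
  · filter_upwards [self_mem_nhdsWithin] with s hs
    exact div_nonneg measureReal_nonneg (le_of_lt hs)
  · filter_upwards [self_mem_nhdsWithin, hall] with s hs h
    rw [div_le_iff₀ hs]
    linarith [sq s]

/-- Up to the points near two of the hyperplanes, the volume of `s • L + M` exceeds that of the
polytope `M` by the volume of the shells of height `s * suppFn L (u k)` over its facets. -/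
lemma abs_volume_add_smul_sub_le {u : Fin N → EuclideanSpace ℝ (Fin n)} (hu : ∀ k, ‖u k‖ = 1)
    {m : Fin N → ℝ} {M L : Set (EuclideanSpace ℝ (Fin n))}
    (hMc : IsCompact M) (hM : M = {x | ∀ k, ⟪x, u k⟫ ≤ m k})
    (hL : IsCompact L) (h0 : (0 : EuclideanSpace ℝ (Fin n)) ∈ L)
    {RL RM : ℝ} (hRL : ∀ x ∈ L, ‖x‖ ≤ RL) (hRM : ∀ x ∈ M, ‖x‖ ≤ RM)
    {s : ℝ} (hs : 0 < s) (hs1 : s ≤ 1) :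
    |volume.real (s • L + M) - volume.real M
        - ∑ k, volume.real (shell M (u k) (m k) (s * suppFn L (u k)))|
      ≤ (N + 1) * volume.real (nearPairs u m (RL + RM) ((2 * RL + 1) * s)) := by
  set Z := nearPairs u m (RL + RM) ((2 * RL + 1) * s) with hZ
  set P : Fin N → Set (EuclideanSpace ℝ (Fin n)) :=
    fun k => shell M (u k) (m k) (s * suppFn L (u k)) with hP
  have hRL0 : 0 ≤ RL := by simpa using hRL 0 h0
  have huu : ∀ k, ⟪u k, u k⟫ = (1 : ℝ) := fun k => by
    rw [real_inner_self_eq_norm_sq, hu]; norm_num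
  have huv : ∀ j k, ⟪u j, u k⟫ ≤ (1 : ℝ) ∧ -1 ≤ ⟪u j, u k⟫ := fun j k => by
    have h : |⟪u j, u k⟫| ≤ 1 := by simpa [hu] using abs_real_inner_le_norm (u j) (u k)
    exact ⟨(abs_le.1 h).2, (abs_le.1 h).1⟩
  have hinner : ∀ x ∈ L, ∀ k, |⟪x, u k⟫| ≤ RL := fun x hx k =>
    (abs_real_inner_le_norm x (u k)).trans (by simpa [hu] using hRL x hx)
  have hh : ∀ k, suppFn L (u k) ≤ RL := fun k =>
    suppFn_le ⟨0, h0⟩ fun x hx => (abs_le.1 (hinner x hx k)).2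
  have hh0 : ∀ k, 0 ≤ suppFn L (u k) := fun k => suppFn_nonneg hL h0 _
  have hMmem : ∀ x, x ∈ M ↔ ∀ k, ⟪x, u k⟫ ≤ m k := fun x => by rw [hM]; rfl
  have hsR : s * RL ≤ RL := by nlinarith
  have hZmem : ∀ x j k, j ≠ k → ‖x‖ ≤ RL + RM →
      m j - (2 * RL + 1) * s ≤ ⟪x, u j⟫ → ⟪x, u j⟫ ≤ m j + s * RL →
      m k - (2 * RL + 1) * s ≤ ⟪x, u k⟫ → ⟪x, u k⟫ ≤ m k + s * RL → x ∈ Z := by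
    intro x j k hjk hx h1 h2 h3 h4
    refine mem_iUnion.2 ⟨⟨(j, k), hjk⟩, hx, abs_le.2 ⟨?_, ?_⟩, abs_le.2 ⟨?_, ?_⟩⟩ <;>
      simp only <;> nlinarith
  have hshell : ∀ k, ∀ x ∈ P k, ‖x‖ ≤ RL + RM ∧ m k < ⟪x, u k⟫ ∧ ⟪x, u k⟫ ≤ m k + s * RL ∧
      ∀ j, ⟪x, u j⟫ ≤ m j + s * RL := by
    rintro k x ⟨h1, h2, h3⟩
    set σ := ⟪x, u k⟫ - m k with hσ
    have hσ0 : 0 < σ := by linarith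
    have hσ1 : σ ≤ s * RL := by
      have := mul_le_mul_of_nonneg_left (hh k) hs.le
      linarith
    refine ⟨?_, h1, by linarith, fun j => ?_⟩
    · calc ‖x‖ = ‖(x - σ • u k) + σ • u k‖ := by simp
        _ ≤ ‖x - σ • u k‖ + ‖σ • u k‖ := norm_add_le _ _
        _ ≤ RM + σ := by
          rw [norm_smul, hu, mul_one, Real.norm_of_nonneg hσ0.le]
          gcongr
          exact hRM _ h3
        _ ≤ _ := by linarith
    · have h4 := (hMmem _).1 h3 j
      rw [inner_sub_left, real_inner_smul_left] at h4
      nlinarith [(huv k j).1]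
  have hA_sub : s • L + M ⊆ (M ∪ ⋃ k ∈ (Finset.univ : Finset (Fin N)), P k) ∪ Z := by
    rintro _ ⟨_, ⟨l, hl, rfl⟩, y, hy, rfl⟩
    by_cases hxM : s • l + y ∈ M
    · exact Or.inl (Or.inl hxM)
    have hin : ∀ k, ⟪s • l + y, u k⟫ ≤ m k + s * suppFn L (u k) := fun k => by
      rw [inner_add_left, real_inner_smul_left]
      have h1 := mul_le_mul_of_nonneg_left (inner_le_suppFn hL (u k) hl) hs.le
      linarith [(hMmem y).1 hy k]
    have hin' : ∀ k, ⟪s • l + y, u k⟫ ≤ m k + s * RL := fun k =>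
      (hin k).trans (by have := mul_le_mul_of_nonneg_left (hh k) hs.le; linarith)
    have hnorm : ‖s • l + y‖ ≤ RL + RM := by
      refine (norm_add_le _ _).trans (add_le_add ?_ (hRM y hy))
      rw [norm_smul, Real.norm_of_nonneg hs.le]
      exact (mul_le_mul_of_nonneg_left (hRL l hl) hs.le).trans hsR
    rw [hMmem] at hxM
    push Not at hxM
    obtain ⟨j, hj⟩ := hxM
    by_cases hk : ∃ k, j ≠ k ∧ m k - (2 * RL + 1) * s ≤ ⟪s • l + y, u k⟫
    · obtain ⟨k, hjk, hk⟩ := hk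
      exact Or.inr (hZmem _ j k hjk hnorm (by nlinarith) (hin' j) hk (hin' k))
    · push Not at hk
      refine Or.inl (Or.inr (mem_iUnion₂.2 ⟨j, Finset.mem_univ _, hj, hin j, ?_⟩))
      rw [hMmem]
      intro k
      rw [inner_sub_left (s • l + y), real_inner_smul_left]
      by_cases hjk : j = k
      · subst hjk
        rw [huu]; linarith
      · have := hk k hjk
        have h2 := hin' j
        nlinarith [(huv j k).2]
  have hB_sub : (M ∪ ⋃ k ∈ (Finset.univ : Finset (Fin N)), P k \ Z) ⊆ s • L + M := by
    refine union_subset (fun y hy => ?_) (iUnion₂_subset fun j _ x hx => ?_)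
    · exact ⟨0, ⟨0, h0, smul_zero _⟩, y, hy, zero_add _⟩
    obtain ⟨hx, hxZ⟩ := hx
    obtain ⟨hnorm, hj1, hj2, hin⟩ := hshell j x hx
    obtain ⟨p, hp, hpj⟩ := exists_inner_eq_suppFn hL ⟨0, h0⟩ (u j)
    refine ⟨s • p, ⟨p, hp, rfl⟩, x - s • p, ?_, by simp⟩
    rw [hMmem]
    intro k
    rw [inner_sub_left, real_inner_smul_left]
    by_cases hjk : j = k
    · subst hjk
      rw [hpj]
      linarith [hx.2.1]
    · by_contra! hcon
      refine hxZ (hZmem x j k hjk hnorm (by nlinarith) hj2 ?_ (hin k))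
      nlinarith [(abs_le.1 (hinner p hp k)).1]
  have hMfin : volume M ≠ ⊤ := hMc.measure_lt_top.ne
  have hPfin : ∀ k, volume (P k) ≠ ⊤ := fun k => (volume_shell_lt_top hMc.isBounded _ _).ne
  have hZfin : volume Z ≠ ⊤ := volume_nearPairs_ne_top _ _ _ _
  have hPm : ∀ k, MeasurableSet (P k) := fun k => measurableSet_shell hMc.isClosed _ _
  have hPZm : ∀ k, MeasurableSet (P k \ Z) :=
    fun k => (hPm k).diff (measurableSet_nearPairs _ _ _ _)
  have hUfin : volume (⋃ k ∈ (Finset.univ : Finset (Fin N)), P k) ≠ ⊤ :=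
    (measure_biUnion_lt_top (Finset.finite_toSet _) fun k _ => (hPfin k).lt_top).ne
  have hAfin : volume (s • L + M) ≠ ⊤ := ((hL.smul s).add hMc).measure_lt_top.ne
  have hupper : volume.real (s • L + M) ≤
      volume.real M + ∑ k, volume.real (P k) + volume.real Z :=
    calc volume.real (s • L + M)
        ≤ volume.real ((M ∪ ⋃ k ∈ (Finset.univ : Finset (Fin N)), P k) ∪ Z) :=
          measureReal_mono hA_sub
            (measure_union_lt_top (measure_union_lt_top hMfin.lt_top hUfin.lt_top)
              hZfin.lt_top).ne
      _ ≤ volume.real M + ∑ k, volume.real (P k) + volume.real Z := by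
          refine (measureReal_union_le _ _).trans ?_
          gcongr
          refine (measureReal_union_le _ _).trans ?_
          gcongr
          exact measureReal_biUnion_finset_le _ _
  have hlower : volume.real M + ∑ k, (volume.real (P k) - volume.real Z) ≤
      volume.real (s • L + M) := by
    have hdisj : Set.PairwiseDisjoint (↑(Finset.univ : Finset (Fin N))) fun k => P k \ Z := by
      intro j _ k _ hjk
      refine Set.disjoint_left.2 fun x hxj hxk => hxj.2 ?_
      obtain ⟨hnorm, hj1, hj2, -⟩ := hshell j x hxj.1
      obtain ⟨-, hk1, hk2, -⟩ := hshell k x hxk.1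
      exact hZmem x j k hjk hnorm (by nlinarith) hj2 (by nlinarith) hk2
    have hdisjM : Disjoint M (⋃ k ∈ (Finset.univ : Finset (Fin N)), P k \ Z) := by
      refine Set.disjoint_left.2 fun x hx hx' => ?_
      obtain ⟨k, -, hk⟩ := mem_iUnion₂.1 hx'
      exact absurd ((hMmem x).1 hx k) (not_le.2 (hshell k x hk.1).2.1)
    have hPle : ∀ k, volume.real (P k) - volume.real Z ≤ volume.real (P k \ Z) := fun k => by
      rw [sub_le_iff_le_add]
      refine (measureReal_mono (subset_sdiff_union (P k) Z)
        (measure_union_lt_top ?_ hZfin.lt_top).ne).trans (measureReal_union_le _ _)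
      exact (measure_mono sdiff_subset).trans_lt (hPfin k).lt_top
    have hPZfin : ∀ k, volume (P k \ Z) ≠ ⊤ := fun k =>
      ((measure_mono sdiff_subset).trans_lt (hPfin k).lt_top).ne
    calc volume.real M + ∑ k, (volume.real (P k) - volume.real Z)
        ≤ volume.real M + ∑ k, volume.real (P k \ Z) := by
          gcongr with k
          exact hPle k
      _ = volume.real (M ∪ ⋃ k ∈ (Finset.univ : Finset (Fin N)), P k \ Z) := by
          rw [measureReal_union hdisjM (Finset.measurableSet_biUnion _ fun k _ => hPZm k) hMfin
            (measure_biUnion_lt_top (Finset.finite_toSet _) fun k _ => (hPZfin k).lt_top).ne,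
            measureReal_biUnion_finset hdisj (fun k _ => hPZm k) (fun k _ => hPZfin k)]
      _ ≤ _ := measureReal_mono hB_sub hAfin
  have hZ0 : 0 ≤ volume.real Z := measureReal_nonneg
  have hN : (0 : ℝ) ≤ N := Nat.cast_nonneg N
  rw [Finset.sum_sub_distrib, Finset.sum_const, Finset.card_univ, Fintype.card_fin,
    nsmul_eq_mul] at hlower
  rw [abs_le]
  constructor <;> nlinarith

lemma tendsto_volume_add_smul {u : Fin N → EuclideanSpace ℝ (Fin n)} (hu : ∀ k, ‖u k‖ = 1)
    (huinj : Function.Injective u) {m : Fin N → ℝ} {M L : Set (EuclideanSpace ℝ (Fin n))}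
    (hMc : IsCompact M) (hM : M = {x | ∀ k, ⟪x, u k⟫ ≤ m k})
    {z : EuclideanSpace ℝ (Fin n)} (hz : ∀ k, ⟪z, u k⟫ < m k)
    (hL : IsCompact L) (h0 : (0 : EuclideanSpace ℝ (Fin n)) ∈ L) :
    Tendsto (fun s : ℝ => (volume.real (s • L + M) - volume.real M) / s) (𝓝[>] 0)
      (𝓝 (∑ k, suppFn L (u k) * volume.real (shell M (u k) (m k) 1))) := by
  obtain ⟨RL, hRL⟩ := hL.isBounded.exists_norm_le
  obtain ⟨RM, hRM⟩ := hMc.isBounded.exists_norm_le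
  have hRL0 : 0 ≤ RL := by simpa using hRL 0 h0
  have hlim := (tendsto_volume_nearPairs hu huinj hz (RL + RM)
    (show 0 < 2 * RL + 1 by linarith)).const_mul ((N : ℝ) + 1)
  rw [mul_zero] at hlim
  rw [tendsto_iff_norm_sub_tendsto_zero]
  refine squeeze_zero' (Eventually.of_forall fun _ => norm_nonneg _) ?_ hlim
  filter_upwards [Ioc_mem_nhdsGT (show (0 : ℝ) < 1 by norm_num)] with s hs
  have hmain := abs_volume_add_smul_sub_le hu hMc hM hL h0 hRL hRM hs.1 hs.2
  have hsum : ∑ k, volume.real (shell M (u k) (m k) (s * suppFn L (u k))) =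
      s * ∑ k, suppFn L (u k) * volume.real (shell M (u k) (m k) 1) := by
    rw [Finset.mul_sum]
    refine Finset.sum_congr rfl fun k _ => ?_
    have hnn : 0 ≤ s * suppFn L (u k) := mul_nonneg hs.1.le (suppFn_nonneg hL h0 _)
    rw [Measure.real, volume_shell hMc.isClosed hMc.isBounded (hu k), ENNReal.toReal_mul,
      ENNReal.toReal_ofReal hnn, Measure.real, mul_assoc]
  rw [hsum] at hmain
  have hs0 : s ≠ 0 := hs.1.ne'
  rw [Real.norm_eq_abs, ← mul_div_assoc, le_div_iff₀ hs.1]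
  refine le_trans (le_of_eq ?_) hmain
  have habs : ∀ y : ℝ, |y| * s = |y * s| := fun y => by rw [abs_mul, abs_of_pos hs.1]
  rw [habs, sub_mul, div_mul_cancel₀ _ hs0, mul_comm s]

end FirstVariation

/-! ### Mixed volumes as functions of one argument -/

section MixedVolume

variable {n N : ℕ}

/-- The family of bodies with `L` in position `0` and `X j` in every other position `j`. -/
def headFamily (L : Set (EuclideanSpace ℝ (Fin n))) (X : Fin n → Set (EuclideanSpace ℝ (Fin n)))
    (j : Fin n) : Set (EuclideanSpace ℝ (Fin n)) :=
  if (j : ℕ) = 0 then L else X j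

/-- The volume of the shell of height one over the face of `M` with outer normal `u`; for a unit
vector `u` this is the `(n-1)`-dimensional volume of that face. -/
noncomputable def faceVol (M : Set (EuclideanSpace ℝ (Fin n))) (u : EuclideanSpace ℝ (Fin n)) : ℝ :=
  volume.real (shell M u (suppFn M u) 1)

/-- The weight of the direction `v` in the mixed area measure of the bodies `X j`, `j ≠ 0`. -/
noncomputable def mixedWeight (X : Fin n → Set (EuclideanSpace ℝ (Fin n)))
    (v : EuclideanSpace ℝ (Fin n)) : ℝ :=
  ((n.factorial : ℝ))⁻¹ * ∑ S : Finset (Fin n), if ∃ i ∈ S, (i : ℕ) = 0 then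
    (-1 : ℝ) ^ (n - S.card) * (if (S.filter fun i : Fin n => (i : ℕ) ≠ 0) = ∅ then 0 else
      faceVol (∑ i ∈ S.filter (fun i : Fin n => (i : ℕ) ≠ 0), X i) v) else 0

/-- `M` is a polytope with nonempty interior all of whose facet normals are among the `u k`. -/
structure IsPolytopeWithNormals (u : Fin N → EuclideanSpace ℝ (Fin n))
    (M : Set (EuclideanSpace ℝ (Fin n))) : Prop where
  isCompact : IsCompact M
  eq_setOf : M = {x | ∀ k, ⟪x, u k⟫ ≤ suppFn M (u k)}
  exists_lt : ∃ z, ∀ k, ⟪z, u k⟫ < suppFn M (u k)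

lemma tendsto_volume_smul_div (hn : 2 ≤ n) (L : Set (EuclideanSpace ℝ (Fin n))) :
    Tendsto (fun s : ℝ => volume.real (s • L) / s) (𝓝[>] 0) (𝓝 0) := by
  have h : Tendsto (fun s : ℝ => s ^ (n - 1) * volume.real L) (𝓝[>] 0) (𝓝 0) := by
    have : Tendsto (fun s : ℝ => s ^ (n - 1) * volume.real L) (𝓝 0)
        (𝓝 (0 ^ (n - 1) * volume.real L)) :=
      ((continuous_pow (n - 1)).mul continuous_const).tendsto 0
    rw [zero_pow (by omega), zero_mul] at this
    exact this.mono_left nhdsWithin_le_nhds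
  refine h.congr' ?_
  filter_upwards [self_mem_nhdsWithin] with s hs
  have hs' : (0 : ℝ) < s := hs
  rw [Measure.real, Measure.real, Measure.addHaar_smul, finrank_euclideanSpace_fin,
    ENNReal.toReal_mul, ENNReal.toReal_ofReal (abs_nonneg _), abs_of_pos (pow_pos hs' n)]
  obtain ⟨m, rfl⟩ : ∃ m, n = m + 1 := ⟨n - 1, by omega⟩
  rw [Nat.add_sub_cancel, eq_div_iff hs'.ne']
  ring

lemma sum_headFamily_of_mem {L : Set (EuclideanSpace ℝ (Fin n))}
    {X : Fin n → Set (EuclideanSpace ℝ (Fin n))} {S : Finset (Fin n)}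
    (hS : ∃ i ∈ S, (i : ℕ) = 0) :
    ∑ i ∈ S, headFamily L X i = L + ∑ i ∈ S.filter (fun i : Fin n => (i : ℕ) ≠ 0), X i := by
  obtain ⟨i₀, hi₀, h0⟩ := hS
  have hf : S.filter (fun i : Fin n => (i : ℕ) ≠ 0) = S.erase i₀ := by
    ext i
    simp only [Finset.mem_filter, Finset.mem_erase, Ne, Fin.ext_iff, h0, and_comm]
  rw [hf, ← Finset.add_sum_erase S _ hi₀]
  congr 1
  · simp [headFamily, h0]
  · refine Finset.sum_congr rfl fun i hi => ?_
    have : (i : ℕ) ≠ 0 := fun h => (Finset.mem_erase.1 hi).1 (Fin.ext (h.trans h0.symm))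
    simp [headFamily, this]

lemma sum_headFamily_of_not_mem {L L' : Set (EuclideanSpace ℝ (Fin n))}
    {X : Fin n → Set (EuclideanSpace ℝ (Fin n))} {S : Finset (Fin n)}
    (hS : ¬ ∃ i ∈ S, (i : ℕ) = 0) :
    ∑ i ∈ S, headFamily L X i = ∑ i ∈ S, headFamily L' X i := by
  refine Finset.sum_congr rfl fun i hi => ?_
  have : (i : ℕ) ≠ 0 := fun h => hS ⟨i, hi, h⟩
  simp [headFamily, this]

/-- If the mixed volume is positively homogeneous in the argument `L`, then it depends on `L` only
through the values of its support function at the facet normals. -/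
lemma mixedVol_sub_mixedVol (hn : 2 ≤ n) {u : Fin N → EuclideanSpace ℝ (Fin n)}
    (hu : ∀ k, ‖u k‖ = 1) (huinj : Function.Injective u)
    {X : Fin n → Set (EuclideanSpace ℝ (Fin n))}
    (hX : ∀ T : Finset (Fin n), T.Nonempty → IsPolytopeWithNormals u (∑ i ∈ T, X i))
    (hhom : ∀ L, IsConvexBody L → ∀ s : ℝ, 0 < s →
      mixedVol n (headFamily (s • L) X) = s * mixedVol n (headFamily L X))
    {L L' : Set (EuclideanSpace ℝ (Fin n))} (hL : IsConvexBody L) (hL' : IsConvexBody L')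
    (h0 : (0 : EuclideanSpace ℝ (Fin n)) ∈ L) (h0' : (0 : EuclideanSpace ℝ (Fin n)) ∈ L') :
    mixedVol n (headFamily L X) - mixedVol n (headFamily L' X) =
      ∑ k, mixedWeight X (u k) * (suppFn L (u k) - suppFn L' (u k)) := by
  have hterm : ∀ S : Finset (Fin n), Tendsto (fun s : ℝ =>
      (volume.real (∑ i ∈ S, headFamily (s • L) X i) -
        volume.real (∑ i ∈ S, headFamily (s • L') X i)) / s) (𝓝[>] 0)
      (𝓝 (if ∃ i ∈ S, (i : ℕ) = 0 then ∑ k, (if (S.filter fun i : Fin n => (i : ℕ) ≠ 0) = ∅ then 0 else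
        faceVol (∑ i ∈ S.filter (fun i : Fin n => (i : ℕ) ≠ 0), X i) (u k)) *
          (suppFn L (u k) - suppFn L' (u k)) else 0)) := by
    intro S
    by_cases hS : ∃ i ∈ S, (i : ℕ) = 0
    · rw [if_pos hS]
      simp_rw [sum_headFamily_of_mem hS]
      set T := S.filter (fun i : Fin n => (i : ℕ) ≠ 0)
      by_cases hT : T = ∅
      · simp only [hT, Finset.sum_empty, add_zero, if_true, zero_mul, Finset.sum_const_zero]
        simpa [sub_div] using
          (tendsto_volume_smul_div hn L).sub (tendsto_volume_smul_div hn L')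
      · obtain ⟨hc, hM, z, hz⟩ := hX T (Finset.nonempty_iff_ne_empty.2 hT)
        have h1 := tendsto_volume_add_smul hu huinj hc hM hz hL.2.1 h0
        have h2 := tendsto_volume_add_smul hu huinj hc hM hz hL'.2.1 h0'
        have h3 := h1.sub h2
        rw [← Finset.sum_sub_distrib] at h3
        simp only [if_neg hT]
        convert h3 using 2
        · ring
        · refine Finset.sum_congr rfl fun k _ => ?_
          simp only [faceVol]; ring
    · rw [if_neg hS]
      simp_rw [sum_headFamily_of_not_mem (L := _ • L) (L' := ∅) hS,
        sum_headFamily_of_not_mem (L := _ • L') (L' := ∅) hS]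
      simp
  have hsum := (tendsto_finsetSum Finset.univ fun S _ =>
    (hterm S).const_mul ((-1 : ℝ) ^ (n - S.card))).const_mul ((n.factorial : ℝ))⁻¹
  have hconst : Tendsto (fun _ : ℝ =>
      mixedVol n (headFamily L X) - mixedVol n (headFamily L' X)) (𝓝[>] (0 : ℝ))
      (𝓝 (mixedVol n (headFamily L X) - mixedVol n (headFamily L' X))) := tendsto_const_nhds
  have hev : (fun s : ℝ => ((n.factorial : ℝ))⁻¹ * ∑ S : Finset (Fin n), (-1 : ℝ) ^ (n - S.card) *
      ((volume.real (∑ i ∈ S, headFamily (s • L) X i) -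
        volume.real (∑ i ∈ S, headFamily (s • L') X i)) / s)) =ᶠ[𝓝[>] (0 : ℝ)]
      fun _ => mixedVol n (headFamily L X) - mixedVol n (headFamily L' X) := by
    filter_upwards [self_mem_nhdsWithin] with s hs
    have hs' : (0 : ℝ) < s := hs
    have h1 := hhom L hL s hs'
    have h2 := hhom L' hL' s hs'
    have h3 : mixedVol n (headFamily L X) - mixedVol n (headFamily L' X) =
        (mixedVol n (headFamily (s • L) X) - mixedVol n (headFamily (s • L') X)) / s := by
      rw [h1, h2]; field_simp
    rw [h3, mixedVol, mixedVol, ← mul_sub, ← Finset.sum_sub_distrib, mul_div_assoc,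
      Finset.sum_div]
    congr 1
    refine Finset.sum_congr rfl fun S _ => ?_
    simp only [Measure.real]
    ring
  rw [tendsto_nhds_unique hconst (hsum.congr' hev)]
  simp only [mixedWeight, Finset.mul_sum, Finset.sum_mul]
  conv_rhs => rw [Finset.sum_comm]
  refine Finset.sum_congr rfl fun S _ => ?_
  by_cases hS : ∃ i ∈ S, (i : ℕ) = 0
  · simp only [if_pos hS, Finset.mul_sum]
    exact Finset.sum_congr rfl fun k _ => by ring
  · simp only [if_neg hS]; simp

end MixedVolume

/-! ### Minkowski sums of the bodies obtained by moving one facet -/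

section MovedPoly

variable {n N : ℕ} {K : Set (EuclideanSpace ℝ (Fin n))} {u : Fin N → EuclideanSpace ℝ (Fin n)}
  {i : Fin N}

lemma movedPoly_zero (hK : K = ⋂ j : Fin N, {x | ⟪x, u j⟫ ≤ suppFn K (u j)}) :
    movedPoly K u i 0 = K := by
  conv_rhs => rw [hK]
  ext x
  simp [movedPoly]

lemma movedPoly_mono {s t : ℝ} (h : s ≤ t) : movedPoly K u i s ⊆ movedPoly K u i t := by
  intro x hx j
  refine (hx j).trans ?_
  split_ifs <;> linarith

lemma isClosed_movedPoly (t : ℝ) : IsClosed (movedPoly K u i t) := by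
  simp only [movedPoly, Set.ofPred_forall]
  exact isClosed_iInter fun j => isClosed_le (by fun_prop) continuous_const

lemma convex_movedPoly (t : ℝ) : Convex ℝ (movedPoly K u i t) := by
  simp only [movedPoly, Set.ofPred_forall]
  refine convex_iInter fun j => convex_halfSpace_le ?_ _
  exact ⟨fun x y => inner_add_left x y _, fun c x => by simp [real_inner_smul_left]⟩

lemma exists_inner_add_le_suppFn (hK : IsCompact K) (hKdim : (interior K).Nonempty)
    (hu : ∀ j, ‖u j‖ = 1) : ∃ z : EuclideanSpace ℝ (Fin n), ∃ ρ : ℝ, 0 < ρ ∧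
      ∀ k, ⟪z, u k⟫ + ρ ≤ suppFn K (u k) := by
  obtain ⟨z, hz⟩ := hKdim
  obtain ⟨ρ, hρ, h⟩ := Metric.nhds_basis_closedBall.mem_iff.1 (mem_interior_iff_mem_nhds.1 hz)
  refine ⟨z, ρ, hρ, fun k => ?_⟩
  have := inner_le_suppFn hK (u k) (x := z + ρ • u k)
    (h (by simp [norm_smul, hu, abs_of_pos hρ]))
  simpa [inner_add_left, real_inner_smul_left, real_inner_self_eq_norm_sq, hu] using this

/-- `X` lies between two translated dilates of `Y` with ratios `1 - η` and `1 + η`. -/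
def Sandwiched (η : ℝ) (X Y : Set (EuclideanSpace ℝ (Fin n))) : Prop :=
  ∃ p q : EuclideanSpace ℝ (Fin n), X ⊆ {p} + (1 + η) • Y ∧ {q} + (1 - η) • Y ⊆ X

lemma sandwiched_movedPoly (hKrep : K = ⋂ j : Fin N, {x | ⟪x, u j⟫ ≤ suppFn K (u j)})
    {z : EuclideanSpace ℝ (Fin n)} {ρ : ℝ}
    (hz : ∀ k, ⟪z, u k⟫ + ρ ≤ suppFn K (u k)) {η t : ℝ} (hη : 0 ≤ η) (hη1 : η ≤ 1)
    (ht : |t| ≤ η * ρ) : Sandwiched η (movedPoly K u i t) K := by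
  have hmem : ∀ x, x ∈ K ↔ ∀ k, ⟪x, u k⟫ ≤ suppFn K (u k) := fun x => by
    conv_lhs => rw [hKrep]
    simp
  have hb : ∀ k, |if k = i then t else 0| ≤ η * (suppFn K (u k) - ⟪z, u k⟫) := fun k => by
    have h1 : η * ρ ≤ η * (suppFn K (u k) - ⟪z, u k⟫) :=
      mul_le_mul_of_nonneg_left (by linarith [hz k]) hη
    split_ifs
    · exact ht.trans h1
    · rw [abs_zero]; exact ((abs_nonneg t).trans ht).trans h1
  refine ⟨(-η) • z, η • z, fun x hx => ?_, ?_⟩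
  · have h1 : (0 : ℝ) < 1 + η := by linarith
    refine Set.mem_add.2 ⟨_, rfl, x + η • z, ?_, by simp⟩
    refine ⟨(1 + η)⁻¹ • (x + η • z), (hmem _).2 fun k => ?_, smul_inv_smul₀ h1.ne' _⟩
    rw [real_inner_smul_left, inner_add_left, real_inner_smul_left, inv_mul_le_iff₀ h1]
    linarith [hx k, (le_abs_self _).trans (hb k)]
  · rintro _ ⟨_, rfl, _, ⟨y, hy, rfl⟩, rfl⟩ k
    have hy' := mul_le_mul_of_nonneg_left ((hmem y).1 hy k) (sub_nonneg.2 hη1)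
    simp only [inner_add_left, real_inner_smul_left]
    linarith [(neg_abs_le (if k = i then t else 0)), hb k]

lemma isCompact_movedPoly (hK : IsCompact K) (hKdim : (interior K).Nonempty)
    (hu : ∀ j, ‖u j‖ = 1) (hKrep : K = ⋂ j : Fin N, {x | ⟪x, u j⟫ ≤ suppFn K (u j)}) (t : ℝ) :
    IsCompact (movedPoly K u i t) := by
  obtain ⟨z, ρ, hρ, hz⟩ := exists_inner_add_le_suppFn hK hKdim hu
  have hmem : ∀ x, x ∈ K ↔ ∀ k, ⟪x, u k⟫ ≤ suppFn K (u k) := fun x => by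
    conv_lhs => rw [hKrep]
    simp
  set η := |t| / ρ with hη'
  have hη : 0 ≤ η := by positivity
  have ht : η * ρ = |t| := div_mul_cancel₀ _ hρ.ne'
  have h1 : (0 : ℝ) < 1 + η := by linarith
  refine ((isCompact_singleton (x := (-η) • z)).add (hK.smul (1 + η))).of_isClosed_subset
    (isClosed_movedPoly t) fun x hx => ?_
  refine Set.mem_add.2 ⟨_, rfl, x + η • z, ?_, by simp⟩
  refine ⟨(1 + η)⁻¹ • (x + η • z), (hmem _).2 fun k => ?_, smul_inv_smul₀ h1.ne' _⟩
  rw [real_inner_smul_left, inner_add_left, real_inner_smul_left, inv_mul_le_iff₀ h1]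
  have h2 : η * ρ ≤ η * (suppFn K (u k) - ⟪z, u k⟫) :=
    mul_le_mul_of_nonneg_left (by linarith [hz k]) hη
  have h3 : (if k = i then t else 0) ≤ η * ρ := by
    split_ifs
    · rw [ht]; exact le_abs_self t
    · positivity
  linarith [hx k]

lemma eventually_exists_active (hK : IsCompact K) (hKdim : (interior K).Nonempty)
    (hu : ∀ j, ‖u j‖ = 1) (hKrep : K = ⋂ j : Fin N, {x | ⟪x, u j⟫ ≤ suppFn K (u j)}) :
    ∀ᶠ t : ℝ in 𝓝 0, ∀ J : Finset (Fin N),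
      (∃ x ∈ movedPoly K u i t, ∀ k ∈ J, ⟪x, u k⟫ = suppFn K (u k) + if k = i then t else 0) →
      ∃ x ∈ K, ∀ k ∈ J, ⟪x, u k⟫ = suppFn K (u k) := by
  rw [Filter.eventually_all]
  intro J
  by_cases hJ : ∃ x ∈ K, ∀ k ∈ J, ⟪x, u k⟫ = suppFn K (u k)
  · exact Eventually.of_forall fun _ _ => hJ
  have hif : ∀ k : Fin N, Continuous fun t : ℝ => if k = i then t else 0 := fun k => by
    split_ifs <;> fun_prop
  set A : Set (EuclideanSpace ℝ (Fin n) × ℝ) := (movedPoly K u i 1 ×ˢ Icc (-1) 1) ∩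
    ({p | ∀ k, ⟪p.1, u k⟫ ≤ suppFn K (u k) + if k = i then p.2 else 0} ∩
      {p | ∀ k ∈ J, ⟪p.1, u k⟫ = suppFn K (u k) + if k = i then p.2 else 0}) with hA
  have hr : ∀ k, Continuous fun p : EuclideanSpace ℝ (Fin n) × ℝ =>
      suppFn K (u k) + if k = i then p.2 else 0 := fun k =>
    continuous_const.add ((hif k).comp continuous_snd)
  have hl : ∀ k, Continuous fun p : EuclideanSpace ℝ (Fin n) × ℝ => ⟪p.1, u k⟫ := fun k => by
    fun_prop
  have hAc : IsCompact A := by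
    refine ((isCompact_movedPoly hK hKdim hu hKrep 1).prod isCompact_Icc).inter_right
      (IsClosed.inter ?_ ?_)
    · simp only [Set.ofPred_forall]
      exact isClosed_iInter fun k => isClosed_le (hl k) (hr k)
    · simp only [Set.ofPred_forall]
      exact isClosed_iInter fun k => isClosed_iInter fun _ => isClosed_eq (hl k) (hr k)
  have h0 : (0 : ℝ) ∉ Prod.snd '' A := by
    rintro ⟨⟨x, t⟩, ⟨-, hx, hx'⟩, rfl⟩
    refine hJ ⟨x, ?_, fun k hk => by simpa using hx' k hk⟩
    rw [← movedPoly_zero (i := i) hKrep]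
    exact hx
  filter_upwards [(hAc.image continuous_snd).isClosed.isOpen_compl.mem_nhds h0,
    Icc_mem_nhds (show (-1 : ℝ) < 0 by norm_num) (show (0 : ℝ) < 1 by norm_num)]
    with t ht ht1
  rintro ⟨x, hx, hxJ⟩
  exact absurd ⟨(x, t), ⟨⟨movedPoly_mono ht1.2 hx, ht1⟩, hx, hxJ⟩, rfl⟩ ht

lemma isCompact_finsetSum {ι : Type*} {X : ι → Set (EuclideanSpace ℝ (Fin n))} {T : Finset ι}
    (h : ∀ j ∈ T, IsCompact (X j)) : IsCompact (∑ j ∈ T, X j) := by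
  classical
  induction T using Finset.induction_on with
  | empty => exact isCompact_singleton
  | insert a T ha ih =>
    rw [Finset.sum_insert ha]
    exact (h a (by simp)).add (ih fun j hj => h j (Finset.mem_insert_of_mem hj))

lemma convex_finsetSum {ι : Type*} {X : ι → Set (EuclideanSpace ℝ (Fin n))} {T : Finset ι}
    (h : ∀ j ∈ T, Convex ℝ (X j)) : Convex ℝ (∑ j ∈ T, X j) := by
  classical
  induction T using Finset.induction_on with
  | empty => exact convex_singleton 0
  | insert a T ha ih =>
    rw [Finset.sum_insert ha]
    exact (h a (by simp)).add (ih fun j hj => h j (Finset.mem_insert_of_mem hj))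

/-- Minkowski sums of copies of `K` and `K_t` are cut out by the facet normals of `K`. -/
lemma mem_sum_movedPoly (hK : IsCompact K) (hKdim : (interior K).Nonempty)
    (hu : ∀ j, ‖u j‖ = 1) (hKrep : K = ⋂ j : Fin N, {x | ⟪x, u j⟫ ≤ suppFn K (u j)}) {t : ℝ}
    (hne : (movedPoly K u i t).Nonempty)
    (hact : ∀ J : Finset (Fin N),
      (∃ x ∈ movedPoly K u i t, ∀ k ∈ J, ⟪x, u k⟫ = suppFn K (u k) + if k = i then t else 0) →
      ∃ x ∈ K, ∀ k ∈ J, ⟪x, u k⟫ = suppFn K (u k))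
    {ι : Type*} {τ : ι → ℝ} (hτ : ∀ j, τ j = t ∨ τ j = 0) {T : Finset ι}
    {y : EuclideanSpace ℝ (Fin n)}
    (hy : ∀ k, ⟪y, u k⟫ ≤ ∑ j ∈ T, (suppFn K (u k) + if k = i then τ j else 0)) :
    y ∈ ∑ j ∈ T, movedPoly K u i (τ j) := by
  classical
  by_contra hy'
  have hc : IsCompact (∑ j ∈ T, movedPoly K u i (τ j)) :=
    isCompact_finsetSum fun j _ => isCompact_movedPoly hK hKdim hu hKrep _
  obtain ⟨f, c, hf, hfy⟩ := geometric_hahn_banach_closed_point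
    (convex_finsetSum fun j _ => convex_movedPoly _) hc.isClosed hy'
  obtain ⟨x, hx, hmax⟩ := (isCompact_movedPoly (i := i) hK hKdim hu hKrep t).exists_isMaxOn hne
    f.continuous.continuousOn
  set J : Finset (Fin N) :=
    Finset.univ.filter fun k => ⟪x, u k⟫ = suppFn K (u k) + if k = i then t else 0 with hJ
  obtain ⟨x₀, hx₀, hx₀J⟩ := hact J ⟨x, hx, fun k hk => (Finset.mem_filter.1 hk).2⟩
  rw [← movedPoly_zero (i := i) hKrep] at hx₀
  set p : ι → EuclideanSpace ℝ (Fin n) := fun j => if τ j = t then x else x₀ with hp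
  have hpmem : ∑ j ∈ T, p j ∈ ∑ j ∈ T, movedPoly K u i (τ j) := by
    refine Set.finsetSum_mem_finsetSum _ _ _ fun j _ => ?_
    simp only [hp]
    split_ifs with h
    · rw [h]; exact hx
    · rw [(hτ j).resolve_left h]; exact hx₀
  have hpJ : ∀ k ∈ J, ∀ j, ⟪p j, u k⟫ = suppFn K (u k) + if k = i then τ j else 0 := by
    intro k hk j
    simp only [hp]
    split_ifs with h h'
    · rw [(Finset.mem_filter.1 hk).2, if_pos h', h]
    · rw [(Finset.mem_filter.1 hk).2, if_neg h']
    · rw [hx₀J k hk, (hτ j).resolve_left h, add_zero]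
    · rw [hx₀J k hk, add_zero]
  set d := y - ∑ j ∈ T, p j with hd
  have hdJ : ∀ k ∈ J, ⟪d, u k⟫ ≤ 0 := by
    intro k hk
    rw [hd, inner_sub_left, sum_inner, Finset.sum_congr rfl fun j _ => hpJ k hk j]
    exact sub_nonpos.2 (hy k)
  have hev : ∀ᶠ ε : ℝ in 𝓝[>] 0, x + ε • d ∈ movedPoly K u i t := by
    have : ∀ k, ∀ᶠ ε : ℝ in 𝓝[>] 0,
        ⟪x + ε • d, u k⟫ ≤ suppFn K (u k) + if k = i then t else 0 := by
      intro k
      by_cases hk : k ∈ J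
      · filter_upwards [self_mem_nhdsWithin] with ε hε
        rw [inner_add_left, real_inner_smul_left, (Finset.mem_filter.1 hk).2]
        have := mul_nonpos_of_nonneg_of_nonpos (le_of_lt hε) (hdJ k hk)
        linarith
      · have hlt : ⟪x, u k⟫ < suppFn K (u k) + if k = i then t else 0 :=
          lt_of_le_of_ne (hx k) fun h => hk (Finset.mem_filter.2 ⟨Finset.mem_univ _, h⟩)
        have hcont : Tendsto (fun ε : ℝ => ⟪x + ε • d, u k⟫) (𝓝[>] 0) (𝓝 ⟪x, u k⟫) := by
          have h := (by fun_prop : Continuous fun ε : ℝ => ⟪x + ε • d, u k⟫).tendsto 0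
          simp only [zero_smul, add_zero] at h
          exact h.mono_left nhdsWithin_le_nhds
        exact (hcont.eventually_lt_const hlt).mono fun ε h => h.le
    exact (Filter.eventually_all.2 this)
  obtain ⟨ε, hεmem, hε⟩ := (hev.and self_mem_nhdsWithin).exists
  have hε' : (0 : ℝ) < ε := hε
  have h1 : f (x + ε • d) ≤ f x := hmax hεmem
  rw [map_add, map_smul, smul_eq_mul] at h1
  have h2 : f d ≤ 0 := by
    by_contra h
    have := mul_pos hε' (not_le.1 h)
    linarith
  have h3 := hf _ hpmem
  rw [hd, map_sub] at h2
  linarith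

lemma isPolytopeWithNormals_sum (hK : IsCompact K)
    (hKdim : (interior K).Nonempty)
    (hu : ∀ j, ‖u j‖ = 1) (hKrep : K = ⋂ j : Fin N, {x | ⟪x, u j⟫ ≤ suppFn K (u j)}) {t : ℝ}
    {z : EuclideanSpace ℝ (Fin n)} {ρ : ℝ}
    (hz : ∀ k, ⟪z, u k⟫ + ρ ≤ suppFn K (u k)) (ht : |t| < ρ)
    (hact : ∀ J : Finset (Fin N),
      (∃ x ∈ movedPoly K u i t, ∀ k ∈ J, ⟪x, u k⟫ = suppFn K (u k) + if k = i then t else 0) →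
      ∃ x ∈ K, ∀ k ∈ J, ⟪x, u k⟫ = suppFn K (u k))
    {ι : Type*} {τ : ι → ℝ} (hτ : ∀ j, τ j = t ∨ τ j = 0) {T : Finset ι} (hT : T.Nonempty) :
    IsPolytopeWithNormals u (∑ j ∈ T, movedPoly K u i (τ j)) := by
  have hc : IsCompact (∑ j ∈ T, movedPoly K u i (τ j)) :=
    isCompact_finsetSum fun j _ => isCompact_movedPoly hK hKdim hu hKrep _
  have hτ' : ∀ j, |τ j| ≤ |t| := fun j => by
    rcases hτ j with h | h <;> simp [h]
  have hball : ∀ v : EuclideanSpace ℝ (Fin n), ‖v‖ ≤ ρ - |t| → ∀ s, |s| ≤ |t| →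
      z + v ∈ movedPoly K u i s := by
    intro v hv s hs k
    have h1 : ⟪v, u k⟫ ≤ ‖v‖ := by simpa [hu] using real_inner_le_norm v (u k)
    have h2 : -|t| ≤ if k = i then s else 0 := by
      split_ifs
      · exact (neg_le_neg hs).trans (neg_abs_le s)
      · simp
    rw [inner_add_left]
    linarith [hz k]
  have hne : (movedPoly K u i t).Nonempty :=
    ⟨z + 0, hball 0 (by simpa using ht.le) t le_rfl⟩
  have hmemball : ∀ v : EuclideanSpace ℝ (Fin n), ‖v‖ ≤ ρ - |t| →
      ∑ _j ∈ T, (z + v) ∈ ∑ j ∈ T, movedPoly K u i (τ j) := fun v hv =>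
    Set.finsetSum_mem_finsetSum _ _ _ fun j _ => hball v hv _ (hτ' j)
  refine ⟨hc, Subset.antisymm (fun x hx k => inner_le_suppFn hc _ hx) fun x hx => ?_,
    ∑ _j ∈ T, z, fun k => ?_⟩
  · refine mem_sum_movedPoly hK hKdim hu hKrep hne hact hτ fun k => (hx k).trans ?_
    refine suppFn_le ⟨_, hmemball 0 (by simpa using ht.le)⟩ fun y hy => ?_
    obtain ⟨g, hg, rfl⟩ := (Set.mem_finsetSum _ _ _).1 hy
    rw [sum_inner]
    exact Finset.sum_le_sum fun j hj => hg hj k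
  · refine lt_of_lt_of_le ?_ (inner_le_suppFn hc (u k) (hmemball ((ρ - |t|) • u k) ?_))
    · rw [sum_inner, sum_inner]
      refine Finset.sum_lt_sum_of_nonempty hT fun j _ => ?_
      rw [inner_add_left, real_inner_smul_left, real_inner_self_eq_norm_sq, hu]
      linarith
    · rw [norm_smul, hu, mul_one, Real.norm_of_nonneg (sub_nonneg.2 ht.le)]

end MovedPoly

/-! ### Positivity of the weights -/

section Positivity

variable {n : ℕ} {K : Set (EuclideanSpace ℝ (Fin n))} {v : EuclideanSpace ℝ (Fin n)}

lemma convex_shell (hK : Convex ℝ K) (m τ : ℝ) : Convex ℝ (shell K v m τ) := by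
  rintro x ⟨hx1, hx2, hx3⟩ y ⟨hy1, hy2, hy3⟩ a b ha hb hab
  have hlin : ⟪a • x + b • y, v⟫ = a * ⟪x, v⟫ + b * ⟪y, v⟫ := by
    simp only [inner_add_left, real_inner_smul_left]
  have hb' : b = 1 - a := by linarith
  refine ⟨?_, ?_, ?_⟩
  · rw [hlin]
    have := (convex_Ioi m) hx1 hy1 ha hb hab
    simpa using this
  · rw [hlin]
    have := (convex_Iic (m + τ)) hx2 hy2 ha hb hab
    simpa using this
  · have := hK hx3 hy3 ha hb hab
    rw [hlin]
    convert this using 1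
    subst hb'
    module

lemma faceVol_smul (hK : IsCompact K) (hv : ‖v‖ = 1) {c : ℝ} (hc : 0 < c) :
    faceVol (c • K) v * c = c ^ n * faceVol K v := by
  have hsh : shell (c • K) v (c * suppFn K v) 1 = c • shell K v (suppFn K v) c⁻¹ := by
    ext x
    rw [mem_smul_set_iff_inv_smul_mem₀ hc.ne']
    simp only [shell, mem_ofPred_eq, real_inner_smul_left, mem_smul_set_iff_inv_smul_mem₀ hc.ne']
    refine and_congr ?_ (and_congr ?_ ?_)
    · rw [lt_inv_mul_iff₀ hc]
    · rw [inv_mul_le_iff₀ hc, mul_add, mul_inv_cancel₀ hc.ne']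
    · rw [show c⁻¹ • (x - (⟪x, v⟫ - c * suppFn K v) • v) =
        c⁻¹ • x - (c⁻¹ * ⟪x, v⟫ - suppFn K v) • v by
          rw [smul_sub, smul_smul, mul_sub, inv_mul_cancel_left₀ hc.ne']]
  have hvol := volume_shell hK.isClosed hK.isBounded hv (suppFn K v) c⁻¹
  rw [faceVol, suppFn_smul_set hc.le, hsh, Measure.real, Measure.addHaar_smul,
    finrank_euclideanSpace_fin, hvol, faceVol, Measure.real, ENNReal.toReal_mul,
    ENNReal.toReal_mul, ENNReal.toReal_ofReal (abs_nonneg _), abs_of_pos (pow_pos hc n),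
    ENNReal.toReal_ofReal (by positivity)]
  field_simp

lemma faceVol_pos (hn : 2 ≤ n) (hK : IsCompact K) (hKc : Convex ℝ K) (hne : K.Nonempty)
    (hv : ‖v‖ = 1) (hfacet : μH[(n : ℝ) - 1] (K ∩ {x | ⟪x, v⟫ = suppFn K v}) ≠ 0) :
    0 < faceVol K v := by
  set F := K ∩ {x | ⟪x, v⟫ = suppFn K v} with hF
  set A := shell K v (suppFn K v) 1 with hA
  have hvv : ⟪v, v⟫ = (1 : ℝ) := by rw [real_inner_self_eq_norm_sq, hv]; norm_num
  obtain ⟨x₀, hx₀, hx₀'⟩ := exists_inner_eq_suppFn hK hne v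
  have hFA : ∀ x ∈ F, ∀ s : ℝ, 0 < s → s ≤ 1 → x + s • v ∈ A := by
    rintro x ⟨hx, hx'⟩ s hs hs1
    have hin : ⟪x + s • v, v⟫ = suppFn K v + s := by
      rw [inner_add_left, real_inner_smul_left, hvv, hx', mul_one]
    refine ⟨by rw [hin]; linarith, by rw [hin]; linarith, ?_⟩
    rw [hin]
    simpa using hx
  have hFc : Convex ℝ F := by
    refine hKc.inter (convex_hyperplane ?_ _)
    exact ⟨fun x y => inner_add_left x y _, fun c x => by simp [real_inner_smul_left]⟩
  by_cases hint : (interior A).Nonempty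
  · have := Measure.measure_pos_of_nonempty_interior (volume : Measure (EuclideanSpace ℝ (Fin n))) hint
    exact ENNReal.toReal_pos this.ne' (volume_shell_lt_top hK.isBounded _ _).ne
  · exfalso
    rw [(convex_shell hKc _ _).interior_nonempty_iff_affineSpan_eq_top] at hint
    have hAne : A.Nonempty := ⟨_, hFA x₀ ⟨hx₀, hx₀'⟩ 1 one_pos le_rfl⟩
    have hvA : vectorSpan ℝ A ≠ ⊤ := fun h =>
      hint ((AffineSubspace.affineSpan_eq_top_iff_vectorSpan_eq_top_of_nonempty ℝ _ _ hAne).2 h)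
    have hle : vectorSpan ℝ F ≤ vectorSpan ℝ A := by
      rw [vectorSpan_def, Submodule.span_le]
      rintro _ ⟨x, hx, y, hy, rfl⟩
      have := vsub_mem_vectorSpan ℝ (hFA x hx 1 one_pos le_rfl) (hFA y hy 1 one_pos le_rfl)
      simpa using this
    have hvmem : v ∈ vectorSpan ℝ A := by
      have := vsub_mem_vectorSpan ℝ (hFA x₀ ⟨hx₀, hx₀'⟩ 1 one_pos le_rfl)
        (hFA x₀ ⟨hx₀, hx₀'⟩ (1 / 2) (by norm_num) (by norm_num))
      have h2 := Submodule.smul_mem _ (2 : ℝ) this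
      convert h2 using 1
      rw [vsub_eq_sub]
      module
    have hvnot : v ∉ vectorSpan ℝ F := by
      have hsub : vectorSpan ℝ F ≤ (innerₛₗ ℝ v).ker := by
        rw [vectorSpan_def, Submodule.span_le]
        rintro _ ⟨x, hx, y, hy, rfl⟩
        have h1 : ⟪x, v⟫ = suppFn K v := hx.2
        have h2 : ⟪y, v⟫ = suppFn K v := hy.2
        simp [real_inner_comm _ v, inner_sub_left, h1, h2]
      intro h
      have := hsub h
      simp at this
      simp [this] at hv
    have hlt : vectorSpan ℝ F < vectorSpan ℝ A :=
      lt_of_le_of_ne hle fun h => hvnot (h ▸ hvmem)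
    have h1 := Submodule.finrank_lt_finrank_of_lt hlt
    have h2 := Submodule.finrank_lt hvA
    rw [finrank_euclideanSpace_fin] at h2
    have hdim : dimH F < ((n - 1 : ℕ) : NNReal) := by
      rw [Real.Convex.dimH_eq_finrank_vectorSpan hFc ⟨x₀, hx₀, hx₀'⟩]
      have : Module.finrank ℝ (vectorSpan ℝ F) < n - 1 := by omega
      exact_mod_cast this
    refine hfacet ?_
    have := hausdorffMeasure_of_dimH_lt hdim
    rwa [NNReal.coe_natCast, Nat.cast_sub (by omega), Nat.cast_one] at this

lemma sum_const_eq_smul (hK : Convex ℝ K) {ι : Type*} {T : Finset ι} (hT : T.Nonempty) :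
    ∑ _j ∈ T, K = (T.card : ℝ) • K := by
  classical
  induction hT using Finset.Nonempty.cons_induction with
  | singleton a => simp
  | cons a T ha hT ih =>
    rw [Finset.sum_cons, ih, Finset.card_cons, Nat.cast_add, Nat.cast_one, add_comm,
      hK.add_smul (Nat.cast_nonneg _) zero_le_one, one_smul]

lemma sum_choose_mul_pow (m : ℕ) :
    ∑ k ∈ Finset.range (m + 1), (m.choose k : ℝ) * ((-1) ^ (m - k) * (k : ℝ) ^ m) =
      m.factorial := by
  have h := congrFun (fwdDiff_iter_eq_factorial (R := ℝ) (n := m)) 0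
  rw [fwdDiff_iter_eq_sum_shift] at h
  simp only [zero_add, nsmul_eq_mul, mul_one, zsmul_eq_mul, Int.cast_mul, Int.cast_pow,
    Int.cast_neg, Int.cast_one, Int.cast_natCast, Pi.natCast_apply] at h
  rw [← h]
  exact Finset.sum_congr rfl fun k _ => by ring

lemma mixedWeight_const (hn : 2 ≤ n) (hK : IsCompact K) (hKc : Convex ℝ K) (hv : ‖v‖ = 1) :
    mixedWeight (fun _ => K) v = ((n.factorial : ℝ))⁻¹ * ((n - 1).factorial * faceVol K v) := by
  obtain ⟨m, rfl⟩ : ∃ m, n = m + 1 := ⟨n - 1, by omega⟩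
  have hm : m ≠ 0 := by omega
  rw [mixedWeight, ← Finset.powerset_univ,
    ← Finset.insert_erase (Finset.mem_univ (0 : Fin (m + 1))),
    Finset.sum_powerset_insert (Finset.notMem_erase _ _)]
  have hzero : ∀ T ∈ (Finset.univ.erase (0 : Fin (m + 1))).powerset, (0 : Fin (m + 1)) ∉ T :=
    fun T hT h => Finset.notMem_erase _ _ (Finset.mem_powerset.1 hT h)
  rw [Finset.sum_eq_zero, zero_add]
  · congr 1
    rw [Nat.add_sub_cancel, ← sum_choose_mul_pow, Finset.sum_mul]
    have hterm : ∀ T ∈ (Finset.univ.erase (0 : Fin (m + 1))).powerset,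
        (if ∃ i ∈ insert (0 : Fin (m + 1)) T, (i : ℕ) = 0 then
          (-1 : ℝ) ^ (m + 1 - (insert (0 : Fin (m + 1)) T).card) *
          (if ((insert (0 : Fin (m + 1)) T).filter fun i : Fin (m + 1) => (i : ℕ) ≠ 0) = ∅ then 0
            else faceVol
              (∑ i ∈ (insert (0 : Fin (m + 1)) T).filter
                (fun i : Fin (m + 1) => (i : ℕ) ≠ 0), K) v) else 0) =
        (fun k : ℕ => (-1 : ℝ) ^ (m - k) * ((k : ℝ) ^ m * faceVol K v)) T.card := by
      intro T hT
      have h0 := hzero T hT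
      have hfil : (insert (0 : Fin (m + 1)) T).filter (fun i : Fin (m + 1) => (i : ℕ) ≠ 0) = T := by
        ext i
        simp only [Finset.mem_filter, Finset.mem_insert, Ne, Fin.val_eq_zero_iff]
        exact ⟨fun h => h.1.resolve_left h.2, fun h => ⟨Or.inr h, fun h' => h0 (h' ▸ h)⟩⟩
      rw [if_pos ⟨0, Finset.mem_insert_self _ _, rfl⟩, hfil, Finset.card_insert_of_notMem h0,
        Nat.add_sub_add_right]
      congr 1
      split_ifs with hT0
      · simp [hT0, hm]
      · have hTne := Finset.nonempty_iff_ne_empty.2 hT0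
        have hc : (0 : ℝ) < T.card := by exact_mod_cast hTne.card_pos
        rw [sum_const_eq_smul hKc hTne]
        have := faceVol_smul hK hv hc
        rw [pow_succ] at this
        exact mul_right_cancel₀ hc.ne' (by rw [this]; ring)
    rw [Finset.sum_congr rfl hterm, Finset.sum_powerset_apply_card
      (fun k : ℕ => (-1 : ℝ) ^ (m - k) * ((k : ℝ) ^ m * faceVol K v)),
      Finset.card_erase_of_mem (Finset.mem_univ _), Finset.card_univ, Fintype.card_fin,
      Nat.add_sub_cancel]
    exact Finset.sum_congr rfl fun k _ => by rw [nsmul_eq_mul]; ring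
  · intro T hT
    rw [if_neg]
    rintro ⟨i, hi, hi0⟩
    exact hzero T hT ((Fin.val_eq_zero_iff.1 hi0) ▸ hi)

end Positivity

/-! ### Continuity of the mixed volumes in the displacement of the facet -/

section Continuity

variable {n N : ℕ} {K : Set (EuclideanSpace ℝ (Fin n))} {u : Fin N → EuclideanSpace ℝ (Fin n)}
  {i : Fin N}

lemma Sandwiched.add {η : ℝ} {X Y X' Y' : Set (EuclideanSpace ℝ (Fin n))}
    (h : Sandwiched η X Y) (h' : Sandwiched η X' Y') : Sandwiched η (X + X') (Y + Y') := by
  obtain ⟨p, q, h1, h2⟩ := h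
  obtain ⟨p', q', h1', h2'⟩ := h'
  refine ⟨p + p', q + q', ?_, ?_⟩
  · rw [smul_add, ← Set.singleton_add_singleton, add_add_add_comm]
    exact Set.add_subset_add h1 h1'
  · rw [smul_add, ← Set.singleton_add_singleton, add_add_add_comm]
    exact Set.add_subset_add h2 h2'

lemma Sandwiched.sum {ι : Type*} {η : ℝ} {X Y : ι → Set (EuclideanSpace ℝ (Fin n))}
    {T : Finset ι} (h : ∀ j ∈ T, Sandwiched η (X j) (Y j)) :
    Sandwiched η (∑ j ∈ T, X j) (∑ j ∈ T, Y j) := by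
  classical
  induction T using Finset.induction_on with
  | empty => exact ⟨0, 0, by simp, by simp⟩
  | insert a T ha ih =>
    rw [Finset.sum_insert ha, Finset.sum_insert ha]
    exact (h a (by simp)).add (ih fun j hj => h j (Finset.mem_insert_of_mem hj))

lemma sandwiched_self {L : Set (EuclideanSpace ℝ (Fin n))} (hL : Convex ℝ L)
    (h0 : (0 : EuclideanSpace ℝ (Fin n)) ∈ L) {η : ℝ} (hη : 0 ≤ η) (hη1 : η ≤ 1) :
    Sandwiched η L L := by
  have h1 : (0 : ℝ) < 1 + η := by linarith
  refine ⟨0, 0, fun x hx => ?_, ?_⟩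
  · rw [Set.singleton_zero, zero_add, mem_smul_set_iff_inv_smul_mem₀ h1.ne']
    exact hL.smul_mem_of_zero_mem h0 hx ⟨by positivity, inv_le_one_of_one_le₀ (by linarith)⟩
  · rw [Set.singleton_zero, zero_add]
    rintro _ ⟨x, hx, rfl⟩
    exact hL.smul_mem_of_zero_mem h0 hx ⟨by linarith, by linarith⟩

lemma volume_real_singleton_add_smul (p : EuclideanSpace ℝ (Fin n)) {s : ℝ} (hs : 0 ≤ s)
    (Y : Set (EuclideanSpace ℝ (Fin n))) :
    volume.real ({p} + s • Y) = s ^ n * volume.real Y := by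
  rw [Set.singleton_add, Set.image_add_left, Measure.real, measure_preimage_add,
    Measure.addHaar_smul, finrank_euclideanSpace_fin, ENNReal.toReal_mul,
    ENNReal.toReal_ofReal (abs_nonneg _), abs_of_nonneg (pow_nonneg hs n), Measure.real]

lemma Sandwiched.volume_le {η : ℝ} {X Y : Set (EuclideanSpace ℝ (Fin n))}
    (h : Sandwiched η X Y) (hη : 0 ≤ η) (hY : IsCompact Y) :
    volume.real X ≤ (1 + η) ^ n * volume.real Y := by
  obtain ⟨p, q, h1, -⟩ := h
  rw [← volume_real_singleton_add_smul p (by linarith)]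
  exact measureReal_mono h1 (isCompact_singleton.add (hY.smul _)).measure_lt_top.ne

lemma Sandwiched.le_volume {η : ℝ} {X Y : Set (EuclideanSpace ℝ (Fin n))}
    (h : Sandwiched η X Y) (hη : η ≤ 1) (hX : IsCompact X) :
    (1 - η) ^ n * volume.real Y ≤ volume.real X := by
  obtain ⟨p, q, -, h2⟩ := h
  rw [← volume_real_singleton_add_smul q (by linarith)]
  exact measureReal_mono h2 hX.measure_lt_top.ne

/-- The family of bodies equal to `K_t` at the positions at most `r`, and to `K` elsewhere. -/
def movedFamily (K : Set (EuclideanSpace ℝ (Fin n))) (u : Fin N → EuclideanSpace ℝ (Fin n))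
    (i : Fin N) (r : ℕ) (t : ℝ) (j : Fin n) : Set (EuclideanSpace ℝ (Fin n)) :=
  movedPoly K u i (if (j : ℕ) ≤ r then t else 0)

lemma isCompact_headFamily (hK : IsCompact K) (hKdim : (interior K).Nonempty)
    (hu : ∀ j, ‖u j‖ = 1) (hKrep : K = ⋂ j : Fin N, {x | ⟪x, u j⟫ ≤ suppFn K (u j)})
    {L : Set (EuclideanSpace ℝ (Fin n))} (hL : IsCompact L) (r : ℕ) (t : ℝ) (j : Fin n) :
    IsCompact (headFamily L (movedFamily K u i r t) j) := by
  rw [headFamily]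
  split_ifs
  · exact hL
  · exact isCompact_movedPoly hK hKdim hu hKrep _

lemma tendsto_mixedVol_movedFamily (hK : IsCompact K) (hKdim : (interior K).Nonempty)
    (hu : ∀ j, ‖u j‖ = 1) (hKrep : K = ⋂ j : Fin N, {x | ⟪x, u j⟫ ≤ suppFn K (u j)})
    {L : Set (EuclideanSpace ℝ (Fin n))} (hL : IsConvexBody L)
    (h0 : (0 : EuclideanSpace ℝ (Fin n)) ∈ L) (r : ℕ) :
    Tendsto (fun t => mixedVol n (headFamily L (movedFamily K u i r t))) (𝓝 0)
      (𝓝 (mixedVol n (headFamily L fun _ => K))) := by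
  refine Tendsto.const_mul _ (tendsto_finsetSum _ fun S _ => Tendsto.const_mul _ ?_)
  obtain ⟨z, ρ, hρ, hz⟩ := exists_inner_add_le_suppFn hK hKdim hu
  have hKz : headFamily L (movedFamily K u i r 0) = headFamily L fun _ => K := by
    funext j
    simp [headFamily, movedFamily, movedPoly_zero hKrep]
  have hlo : Tendsto (fun t : ℝ => (1 - |t| / ρ) ^ n *
      volume.real (∑ j ∈ S, headFamily L (fun _ => K) j)) (𝓝 0)
      (𝓝 (volume.real (∑ j ∈ S, headFamily L (fun _ => K) j))) := by
    have h : Continuous fun t : ℝ => (1 - |t| / ρ) ^ n *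
      volume.real (∑ j ∈ S, headFamily L (fun _ => K) j) := by fun_prop
    simpa using h.tendsto 0
  have hhi : Tendsto (fun t : ℝ => (1 + |t| / ρ) ^ n *
      volume.real (∑ j ∈ S, headFamily L (fun _ => K) j)) (𝓝 0)
      (𝓝 (volume.real (∑ j ∈ S, headFamily L (fun _ => K) j))) := by
    have h : Continuous fun t : ℝ => (1 + |t| / ρ) ^ n *
      volume.real (∑ j ∈ S, headFamily L (fun _ => K) j) := by fun_prop
    simpa using h.tendsto 0
  have hsand : ∀ᶠ t : ℝ in 𝓝 0, |t| / ρ ≤ 1 ∧ Sandwiched (|t| / ρ)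
      (∑ j ∈ S, headFamily L (movedFamily K u i r t) j) (∑ j ∈ S, headFamily L (fun _ => K) j) := by
    filter_upwards [Icc_mem_nhds (neg_lt_zero.2 hρ) hρ] with t ht
    have hη1 : |t| / ρ ≤ 1 := (div_le_one hρ).2 (abs_le.2 ht)
    have hη0 : 0 ≤ |t| / ρ := by positivity
    refine ⟨hη1, Sandwiched.sum fun j _ => ?_⟩
    rw [headFamily, headFamily]
    split_ifs
    · exact sandwiched_self hL.1 h0 hη0 hη1
    · refine sandwiched_movedPoly hKrep hz hη0 hη1 ?_
      rw [div_mul_cancel₀ _ hρ.ne']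
      split_ifs <;> simp
  refine tendsto_of_tendsto_of_tendsto_of_le_of_le' hlo hhi ?_ ?_
  · filter_upwards [hsand] with t ht
    exact ht.2.le_volume ht.1 (isCompact_finsetSum fun j _ =>
      isCompact_headFamily hK hKdim hu hKrep hL.2.1 r t j)
  · filter_upwards [hsand] with t ht
    refine ht.2.volume_le (by positivity) (isCompact_finsetSum fun j _ => ?_)
    rw [← hKz]
    exact isCompact_headFamily hK hKdim hu hKrep hL.2.1 r 0 j

end Continuity

/-! ### Supports of measures representing functionals of support functions -/

section Support

variable {n : ℕ} {w v : EuclideanSpace ℝ (Fin n)} {ε : ℝ}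

/-- The unit ball with the cap of height `ε` in the direction `w` cut off. -/
def truncatedBall (w : EuclideanSpace ℝ (Fin n)) (ε : ℝ) : Set (EuclideanSpace ℝ (Fin n)) :=
  closedBall 0 1 ∩ {x | ⟪x, w⟫ ≤ 1 - ε}

lemma zero_mem_truncatedBall (hε : ε ≤ 1) : 0 ∈ truncatedBall w ε :=
  ⟨by simp, by simpa using hε⟩

lemma isConvexBody_truncatedBall (hε : ε ≤ 1) : IsConvexBody (truncatedBall w ε) := by
  refine ⟨(convex_closedBall _ _).inter (convex_halfSpace_le ?_ _),
    (isCompact_closedBall _ _).inter_right (isClosed_le (by fun_prop) continuous_const),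
    0, zero_mem_truncatedBall hε⟩
  exact ⟨fun x y => inner_add_left x y _, fun c x => by simp [real_inner_smul_left]⟩

lemma isConvexBody_unitBall : IsConvexBody (closedBall (0 : EuclideanSpace ℝ (Fin n)) 1) :=
  ⟨convex_closedBall _ _, isCompact_closedBall _ _, 0, by simp⟩

lemma suppFn_truncatedBall_le_one (hε : ε ≤ 1) (hv : ‖v‖ = 1) :
    suppFn (truncatedBall w ε) v ≤ 1 := by
  refine suppFn_le ⟨0, zero_mem_truncatedBall hε⟩ fun x hx => ?_
  rw [← suppFn_closedBall hv]
  exact inner_le_suppFn (isCompact_closedBall _ _) v hx.1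

lemma suppFn_truncatedBall_self_le (hε : ε ≤ 1) : suppFn (truncatedBall w ε) w ≤ 1 - ε :=
  suppFn_le ⟨0, zero_mem_truncatedBall hε⟩ fun _ hx => hx.2

lemma suppFn_truncatedBall_eq_one_iff (hε : ε ≤ 1) (hv : ‖v‖ = 1) :
    suppFn (truncatedBall w ε) v = 1 ↔ ⟪v, w⟫ ≤ 1 - ε := by
  have hL := isConvexBody_truncatedBall (w := w) hε
  constructor
  · intro h
    obtain ⟨x, hx, hxv⟩ := exists_inner_eq_suppFn hL.2.1 hL.2.2 v
    have hx1 : ‖x‖ ≤ 1 := by simpa using hx.1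
    have hxv' : x = v := by
      have h1 := norm_sub_sq_real x v
      have h2 : ‖x‖ ^ 2 ≤ 1 := pow_le_one₀ (norm_nonneg _) hx1
      rw [hxv, h, hv] at h1
      have h3 : ‖x - v‖ ^ 2 ≤ 0 := by linarith
      exact sub_eq_zero.1 (norm_eq_zero.1 (pow_eq_zero_iff two_ne_zero |>.1
        (le_antisymm h3 (sq_nonneg _))))
    exact hxv' ▸ hx.2
  · intro h
    refine le_antisymm (suppFn_truncatedBall_le_one hε hv) ?_
    have := inner_le_suppFn hL.2.1 v (x := v) ⟨by simp [hv], h⟩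
    simpa [real_inner_self_eq_norm_sq, hv] using this

lemma continuous_suppFn_truncatedBall (hε : ε ≤ 1) :
    Continuous (suppFn (truncatedBall w ε)) := by
  refine (LipschitzWith.of_le_add fun v v' => ?_).continuous
  have hL := isConvexBody_truncatedBall (w := w) hε
  refine suppFn_le hL.2.2 fun x hx => ?_
  have h1 := inner_le_suppFn hL.2.1 v' hx
  have h2 : ⟪x, v - v'⟫ ≤ dist v v' := by
    rw [dist_eq_norm]
    refine (real_inner_le_norm _ _).trans (mul_le_of_le_one_left (norm_nonneg _) ?_)
    simpa using hx.1
  rw [inner_sub_right] at h2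
  linarith

/-- The support of a measure on the sphere that represents a functional `V` is determined by the
values of `V` at truncated balls. -/
lemma mem_msupport_iff (hn : n ≠ 0) {V : Set (EuclideanSpace ℝ (Fin n)) → ℝ}
    {μ : Measure (Metric.sphere (0 : EuclideanSpace ℝ (Fin n)) 1)}
    (hV : ∀ L, IsConvexBody L → V L = (1 / n) *
      ∫ w : Metric.sphere (0 : EuclideanSpace ℝ (Fin n)) 1, suppFn L (w : EuclideanSpace ℝ (Fin n)) ∂μ)
    (hV0 : V (closedBall 0 1) ≠ 0) (w : Metric.sphere (0 : EuclideanSpace ℝ (Fin n)) 1) :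
    w ∈ msupport μ ↔ ∀ ε : ℝ, 0 < ε → ε < 1 → V (closedBall 0 1) ≠ V (truncatedBall w ε) := by
  have hnorm : ∀ v : Metric.sphere (0 : EuclideanSpace ℝ (Fin n)) 1,
      ‖(v : EuclideanSpace ℝ (Fin n))‖ = 1 := fun v => by simp
  have hn' : (1 / n : ℝ) ≠ 0 := by positivity
  have hB : V (closedBall 0 1) = (1 / n) *
      ∫ _ : Metric.sphere (0 : EuclideanSpace ℝ (Fin n)) 1, (1 : ℝ) ∂μ := by
    rw [hV _ isConvexBody_unitBall]
    congr 2
    funext v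
    exact suppFn_closedBall (hnorm v)
  have hfin : IsFiniteMeasure μ := by
    refine ⟨lt_top_iff_ne_top.2 fun h => hV0 ?_⟩
    rw [hB, integral_const, Measure.real, h]
    simp
  constructor
  · intro hw ε hε hε1 heq
    refine hw {v | 1 - ε < ⟪(v : EuclideanSpace ℝ (Fin n)), (w : EuclideanSpace ℝ (Fin n))⟫}
      (isOpen_lt continuous_const (by fun_prop)) ?_ ?_
    · simp only [mem_ofPred_eq]
      rw [real_inner_self_eq_norm_sq, hnorm]
      linarith
    · set g : Metric.sphere (0 : EuclideanSpace ℝ (Fin n)) 1 → ℝ :=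
        fun v => suppFn (truncatedBall (w : EuclideanSpace ℝ (Fin n)) ε) v with hg
      have hgc : Continuous g :=
        (continuous_suppFn_truncatedBall hε1.le).comp continuous_subtype_val
      have hgi : Integrable g μ := by
        refine (integrable_const (1 : ℝ)).mono hgc.aestronglyMeasurable
          (Eventually.of_forall fun v => ?_)
        rw [Real.norm_of_nonneg (suppFn_nonneg (isConvexBody_truncatedBall hε1.le).2.1
          (zero_mem_truncatedBall hε1.le) _)]
        simpa using suppFn_truncatedBall_le_one hε1.le (hnorm v)
      have hint : ∫ v, (1 - g v) ∂μ = 0 := by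
        rw [integral_sub (integrable_const _) hgi, sub_eq_zero]
        rw [hB, hV _ (isConvexBody_truncatedBall hε1.le)] at heq
        exact mul_left_cancel₀ hn' heq
      rw [integral_eq_zero_iff_of_nonneg
        (fun v => sub_nonneg.2 (suppFn_truncatedBall_le_one hε1.le (hnorm v)))
        ((integrable_const _).sub hgi)] at hint
      rw [Filter.EventuallyEq, ae_iff] at hint
      refine measure_mono_null (fun v hv => ?_) hint
      intro h
      have h1 : g v = 1 := by
        have : 1 - g v = 0 := h
        linarith
      exact absurd ((suppFn_truncatedBall_eq_one_iff hε1.le (hnorm v)).1 h1) (not_le.2 hv)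
  · intro h U hU hwU hμU
    obtain ⟨η, hη, hηU⟩ := Metric.isOpen_iff.1 hU w hwU
    obtain ⟨ε, hε, hε1, hεη⟩ : ∃ ε : ℝ, 0 < ε ∧ ε < 1 ∧ 2 * ε < η ^ 2 := by
      refine ⟨min (1 / 2) (η ^ 2 / 4), by positivity, by
        linarith [min_le_left (1 / 2 : ℝ) (η ^ 2 / 4)], ?_⟩
      have : 0 < η ^ 2 := by positivity
      linarith [min_le_right (1 / 2 : ℝ) (η ^ 2 / 4)]
    refine h ε hε hε1 ?_
    rw [hB, hV _ (isConvexBody_truncatedBall hε1.le)]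
    congr 1
    refine integral_congr_ae ?_
    have hae : ∀ᵐ v ∂μ, v ∉ U := by rwa [ae_iff, show {v | ¬ v ∉ U} = U by ext; simp]
    filter_upwards [hae] with v hv
    refine ((suppFn_truncatedBall_eq_one_iff hε1.le (hnorm v)).2 ?_).symm
    by_contra hlt
    refine hv (hηU ?_)
    rw [mem_ball, Subtype.dist_eq, dist_eq_norm]
    have h1 := norm_sub_sq_real (v : EuclideanSpace ℝ (Fin n)) w
    rw [hnorm, hnorm] at h1
    refine lt_of_pow_lt_pow_left₀ 2 hη.le ?_
    linarith [not_le.1 hlt]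

end Support

/-! ### Moving one facet -/

section Main

variable {n N : ℕ} {K : Set (EuclideanSpace ℝ (Fin n))} {u : Fin N → EuclideanSpace ℝ (Fin n)}
  {i : Fin N}

lemma mixedVol_smul_of_forall {V : Set (EuclideanSpace ℝ (Fin n)) → ℝ}
    {μ : Measure (Metric.sphere (0 : EuclideanSpace ℝ (Fin n)) 1)}
    (hV : ∀ L, IsConvexBody L → V L = (1 / n) *
      ∫ w : Metric.sphere (0 : EuclideanSpace ℝ (Fin n)) 1, suppFn L (w : EuclideanSpace ℝ (Fin n)) ∂μ)
    (L : Set (EuclideanSpace ℝ (Fin n))) (hL : IsConvexBody L) (s : ℝ) (hs : 0 < s) :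
    V (s • L) = s * V L := by
  rw [hV _ (IsConvexBody.smul hL), hV _ hL]
  simp_rw [suppFn_smul_set hs.le]
  rw [integral_const_mul]
  ring

/-- If all facet weights are positive, the functional of `L` distinguishes the unit ball from a
truncated ball exactly when the truncation cuts off a facet normal. -/
lemma eq_truncatedBall_iff {V : Set (EuclideanSpace ℝ (Fin n)) → ℝ} {c : Fin N → ℝ}
    (hu : ∀ k, ‖u k‖ = 1) (hc : ∀ k, 0 < c k)
    (hV : ∀ L L', IsConvexBody L → IsConvexBody L' → (0 : EuclideanSpace ℝ (Fin n)) ∈ L →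
      (0 : EuclideanSpace ℝ (Fin n)) ∈ L' →
      V L - V L' = ∑ k, c k * (suppFn L (u k) - suppFn L' (u k)))
    {w : EuclideanSpace ℝ (Fin n)} {ε : ℝ} (hε : ε < 1) :
    V (closedBall 0 1) = V (truncatedBall w ε) ↔ ∀ k, ⟪u k, w⟫ ≤ 1 - ε := by
  rw [← sub_eq_zero, hV _ _ isConvexBody_unitBall (isConvexBody_truncatedBall hε.le) (by simp)
    (zero_mem_truncatedBall hε.le), Finset.sum_eq_zero_iff_of_nonneg]
  · refine ⟨fun h k => ?_, fun h k _ => ?_⟩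
    · have := (mul_eq_zero.1 (h k (Finset.mem_univ k))).resolve_left (hc k).ne'
      rw [suppFn_closedBall (hu k), sub_eq_zero] at this
      exact (suppFn_truncatedBall_eq_one_iff hε.le (hu k)).1 this.symm
    · rw [(suppFn_truncatedBall_eq_one_iff hε.le (hu k)).2 (h k), suppFn_closedBall (hu k),
        sub_self, mul_zero]
  · intro k _
    rw [suppFn_closedBall (hu k)]
    exact mul_nonneg (hc k).le (sub_nonneg.2 (suppFn_truncatedBall_le_one hε.le (hu k)))

lemma unitBall_ne_zero {V : Set (EuclideanSpace ℝ (Fin n)) → ℝ} {c : Fin N → ℝ} (i : Fin N)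
    (hu : ∀ k, ‖u k‖ = 1) (hc : ∀ k, 0 < c k)
    (hV : ∀ L L', IsConvexBody L → IsConvexBody L' → (0 : EuclideanSpace ℝ (Fin n)) ∈ L →
      (0 : EuclideanSpace ℝ (Fin n)) ∈ L' →
      V L - V L' = ∑ k, c k * (suppFn L (u k) - suppFn L' (u k)))
    (hhom : ∀ L, IsConvexBody L → ∀ s : ℝ, 0 < s → V (s • L) = s * V L) :
    V (closedBall 0 1) ≠ 0 := by
  have h0 : V {0} = 0 := by
    have h := hhom {0} IsConvexBody.singleton_zero 2 two_pos
    rw [Set.smul_set_singleton, smul_zero] at h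
    linarith
  have h := hV _ _ isConvexBody_unitBall IsConvexBody.singleton_zero (by simp) rfl
  rw [h0, sub_zero] at h
  rw [h]
  refine (Finset.sum_pos (fun k _ => ?_) ⟨i, Finset.mem_univ i⟩).ne'
  rw [suppFn_closedBall (hu k), suppFn_zero, sub_zero, mul_one]
  exact hc k

lemma IsMixedAreaMeasure.eq_headFamily {r : ℕ} {t : ℝ}
    {μ : Measure (Metric.sphere (0 : EuclideanSpace ℝ (Fin n)) 1)}
    (hKrep : K = ⋂ j : Fin N, {x | ⟪x, u j⟫ ≤ suppFn K (u j)})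
    (h : IsMixedAreaMeasure n r (movedPoly K u i t) K μ) (L : Set (EuclideanSpace ℝ (Fin n)))
    (hL : IsConvexBody L) :
    mixedVol n (headFamily L (movedFamily K u i r t)) = (1 / n) *
      ∫ w : Metric.sphere (0 : EuclideanSpace ℝ (Fin n)) 1,
        suppFn L (w : EuclideanSpace ℝ (Fin n)) ∂μ := by
  rw [← h L hL]
  congr 1
  funext j
  rw [headFamily, movedFamily]
  split_ifs
  · rfl
  · rfl
  · exact movedPoly_zero hKrep

lemma exists_forall_inner_le (hu : ∀ j, ‖u j‖ = 1) (huinj : Function.Injective u) (k : Fin N) :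
    ∃ ε : ℝ, 0 < ε ∧ ε < 1 ∧ ∀ j, j ≠ k → ⟪u j, u k⟫ ≤ 1 - ε := by
  have h : ∀ᶠ ε : ℝ in 𝓝[>] 0, ∀ j, j ≠ k → ⟪u j, u k⟫ ≤ 1 - ε := by
    refine Filter.eventually_all.2 fun j => ?_
    by_cases hj : j = k
    · exact Eventually.of_forall fun _ h => absurd hj h
    · have hlt : ⟪u j, u k⟫ < 1 :=
        (inner_lt_one_iff_real_of_norm_eq_one (hu j) (hu k)).2 fun h => hj (huinj h)
      filter_upwards [Ioo_mem_nhdsGT (sub_pos.2 hlt)] with ε hε _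
      linarith [hε.2]
  obtain ⟨ε, h1, h2⟩ := (h.and (Ioo_mem_nhdsGT (zero_lt_one (α := ℝ)))).exists
  exact ⟨ε, h2.1, h2.2, h1⟩

lemma sum_weight_truncatedBall (hu : ∀ j, ‖u j‖ = 1) {k : Fin N} {ε : ℝ} (hε : ε < 1)
    (h : ∀ j, j ≠ k → ⟪u j, u k⟫ ≤ 1 - ε) (c : Fin N → ℝ) :
    ∑ j, c j * (suppFn (closedBall 0 1) (u j) - suppFn (truncatedBall (u k) ε) (u j)) =
      c k * (1 - suppFn (truncatedBall (u k) ε) (u k)) := by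
  rw [Finset.sum_eq_single_of_mem k (Finset.mem_univ k), suppFn_closedBall (hu k)]
  intro j _ hj
  rw [(suppFn_truncatedBall_eq_one_iff hε.le (hu j)).2 (h j hj), suppFn_closedBall (hu j),
    sub_self, mul_zero]

/-- Small displacements of a facet keep the weights of the facet normals positive. -/
lemma eventually_weights_pos (hn : 2 ≤ n) (hK : IsConvexBody K) (hKdim : (interior K).Nonempty)
    (hu : ∀ j, ‖u j‖ = 1) (huinj : Function.Injective u)
    (hKrep : K = ⋂ j : Fin N, {x | ⟪x, u j⟫ ≤ suppFn K (u j)})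
    (hfacet : ∀ j : Fin N,
      μH[(n : ℝ) - 1] (K ∩ {x | ⟪x, u j⟫ = suppFn K (u j)}) ≠ 0)
    {ν : Measure (Metric.sphere (0 : EuclideanSpace ℝ (Fin n)) 1)}
    (hν : IsMixedAreaMeasure n 0 K K ν) :
    ∀ᶠ t : ℝ in 𝓝 0, ∀ r : ℕ, r < n →
      ∀ μ : Measure (Metric.sphere (0 : EuclideanSpace ℝ (Fin n)) 1),
        IsMixedAreaMeasure n r (movedPoly K u i t) K μ →
        ∃ c : Fin N → ℝ, (∀ k, 0 < c k) ∧
          ∀ L L', IsConvexBody L → IsConvexBody L' → (0 : EuclideanSpace ℝ (Fin n)) ∈ L →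
            (0 : EuclideanSpace ℝ (Fin n)) ∈ L' →
            mixedVol n (headFamily L (movedFamily K u i r t)) -
              mixedVol n (headFamily L' (movedFamily K u i r t)) =
                ∑ k, c k * (suppFn L (u k) - suppFn L' (u k)) := by
  obtain ⟨z, ρ, hρ, hz⟩ := exists_inner_add_le_suppFn hK.2.1 hKdim hu
  have hfam0 : ∀ r, movedFamily K u i r 0 = fun _ : Fin n => K := fun r => by
    funext j
    simp [movedFamily, movedPoly_zero hKrep]
  have hpos0 : ∀ k, 0 < mixedWeight (fun _ => K) (u k) := fun k => by
    rw [mixedWeight_const hn hK.2.1 hK.1 (hu k)]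
    have := faceVol_pos hn hK.2.1 hK.1 hK.2.2 (hu k) (hfacet k)
    positivity
  choose ε hε hε1 hεu using exists_forall_inner_le hu huinj
  have hpoly0 : ∀ T : Finset (Fin n), T.Nonempty → IsPolytopeWithNormals u (∑ _j ∈ T, K) := by
    intro T hT
    have := isPolytopeWithNormals_sum (i := i) (t := 0) (τ := fun _ : Fin n => (0 : ℝ)) hK.2.1
      hKdim hu hKrep hz (by simpa using hρ) (fun J hJ => by
        rw [movedPoly_zero hKrep] at hJ
        simpa using hJ) (fun _ => Or.inl rfl) hT
    rwa [movedPoly_zero hKrep] at this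
  have hν' : ∀ L, IsConvexBody L → mixedVol n (headFamily L fun _ => K) = (1 / n) *
      ∫ w : Metric.sphere (0 : EuclideanSpace ℝ (Fin n)) 1,
        suppFn L (w : EuclideanSpace ℝ (Fin n)) ∂ν := by
    intro L hL
    rw [← movedPoly_zero (i := i) hKrep] at hν
    have := IsMixedAreaMeasure.eq_headFamily (r := 0) (i := i) (t := 0) (μ := ν) hKrep
      (by rw [movedPoly_zero hKrep] at hν ⊢; exact hν) L hL
    rwa [hfam0] at this
  have hgap0 : ∀ k, 0 < mixedVol n (headFamily (closedBall 0 1) fun _ => K) -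
      mixedVol n (headFamily (truncatedBall (u k) (ε k)) fun _ => K) := fun k => by
    rw [mixedVol_sub_mixedVol hn hu huinj hpoly0 (mixedVol_smul_of_forall
      (V := fun L => mixedVol n (headFamily L fun _ => K)) hν') isConvexBody_unitBall
      (isConvexBody_truncatedBall (hε1 k).le) (by simp) (zero_mem_truncatedBall (hε1 k).le),
      sum_weight_truncatedBall hu (hε1 k) (hεu k)]
    have := suppFn_truncatedBall_self_le (w := u k) (hε1 k).le
    exact mul_pos (hpos0 k) (by linarith [hε k])
  have hgap : ∀ᶠ t : ℝ in 𝓝 0, ∀ r ∈ Finset.range n, ∀ k,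
      0 < mixedVol n (headFamily (closedBall 0 1) (movedFamily K u i r t)) -
        mixedVol n (headFamily (truncatedBall (u k) (ε k)) (movedFamily K u i r t)) := by
    refine (Filter.eventually_all_finset _).2 fun r _ => Filter.eventually_all.2 fun k => ?_
    exact ((tendsto_mixedVol_movedFamily hK.2.1 hKdim hu hKrep isConvexBody_unitBall
      (by simp) r).sub (tendsto_mixedVol_movedFamily hK.2.1 hKdim hu hKrep
        (isConvexBody_truncatedBall (hε1 k).le) (zero_mem_truncatedBall (hε1 k).le)
        r)).eventually_const_lt (hgap0 k)
  filter_upwards [hgap, eventually_exists_active (i := i) hK.2.1 hKdim hu hKrep,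
    Ioo_mem_nhds (neg_lt_zero.2 hρ) hρ] with t htgap htact ht r hr μ hμ
  have hdiff := fun L L' hL hL' => mixedVol_sub_mixedVol hn hu huinj (L := L) (L' := L')
    (X := movedFamily K u i r t)
    (fun T hT => isPolytopeWithNormals_sum hK.2.1 hKdim hu hKrep hz (abs_lt.2 ht) htact
      (fun j => by split_ifs <;> simp) hT)
    (mixedVol_smul_of_forall (V := fun L => mixedVol n (headFamily L (movedFamily K u i r t)))
      (IsMixedAreaMeasure.eq_headFamily hKrep hμ)) hL hL'
  refine ⟨fun k => mixedWeight (movedFamily K u i r t) (u k), fun k => ?_, hdiff⟩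
  have h1 := htgap r (Finset.mem_range.2 hr) k
  rw [hdiff _ _ isConvexBody_unitBall (isConvexBody_truncatedBall (hε1 k).le) (by simp)
    (zero_mem_truncatedBall (hε1 k).le), sum_weight_truncatedBall hu (hε1 k) (hεu k)] at h1
  have := suppFn_truncatedBall_self_le (w := u k) (hε1 k).le
  exact pos_of_mul_pos_left h1 (by linarith [hε k])

lemma mixedVol_one (f : Fin 1 → Set (EuclideanSpace ℝ (Fin 1))) :
    mixedVol 1 f = volume.real (f 0) := by
  have h : (Finset.univ : Finset (Finset (Fin 1))) = {∅, {0}} := by decide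
  rw [mixedVol, h, Finset.sum_pair (by decide)]
  simp only [Finset.card_empty, Finset.sum_empty, Finset.card_singleton, Finset.sum_singleton,
    ← Set.singleton_zero, measure_singleton]
  simp [Measure.real]

lemma msupport_eq_of_representing (hn : n ≠ 0) {V V' : Set (EuclideanSpace ℝ (Fin n)) → ℝ}
    {μ ν : Measure (Metric.sphere (0 : EuclideanSpace ℝ (Fin n)) 1)}
    (hV : ∀ L, IsConvexBody L → V L = (1 / n) *
      ∫ w : Metric.sphere (0 : EuclideanSpace ℝ (Fin n)) 1, suppFn L (w : EuclideanSpace ℝ (Fin n)) ∂μ)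
    (hV' : ∀ L, IsConvexBody L → V' L = (1 / n) *
      ∫ w : Metric.sphere (0 : EuclideanSpace ℝ (Fin n)) 1, suppFn L (w : EuclideanSpace ℝ (Fin n)) ∂ν)
    (h0 : V (closedBall 0 1) ≠ 0) (h0' : V' (closedBall 0 1) ≠ 0)
    (h : ∀ (w : EuclideanSpace ℝ (Fin n)) (ε : ℝ), ε < 1 →
      (V (closedBall 0 1) = V (truncatedBall w ε) ↔
        V' (closedBall 0 1) = V' (truncatedBall w ε))) :
    msupport μ = msupport ν := by
  ext w
  rw [mem_msupport_iff hn hV h0, mem_msupport_iff hn hV' h0']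
  exact forall_congr' fun ε => forall_congr' fun _ => forall_congr' fun hε1 =>
    not_congr (h w ε hε1)

lemma msupport_eq_of_dim_one {r : ℕ} {K K' : Set (EuclideanSpace ℝ (Fin 1))}
    {μ ν : Measure (Metric.sphere (0 : EuclideanSpace ℝ (Fin 1)) 1)}
    (hμ : IsMixedAreaMeasure 1 r K' K μ) (hν : IsMixedAreaMeasure 1 0 K K ν) :
    msupport μ = msupport ν := by
  have hB : volume.real (closedBall (0 : EuclideanSpace ℝ (Fin 1)) 1) ≠ 0 :=
    (ENNReal.toReal_pos (measure_closedBall_pos _ _ one_pos).ne'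
      measure_closedBall_lt_top.ne).ne'
  refine msupport_eq_of_representing one_ne_zero (V := volume.real) (V' := volume.real)
    (fun L hL => ?_) (fun L hL => ?_) hB hB fun w ε _ => Iff.rfl
  · rw [← hμ L hL, mixedVol_one]; rfl
  · rw [← hν L hL, mixedVol_one]; rfl

lemma exists_msupport_eq (hn : 1 ≤ n) (hK : IsConvexBody K) (hKdim : (interior K).Nonempty)
    (hu : ∀ j, ‖u j‖ = 1) (huinj : Function.Injective u)
    (hKrep : K = ⋂ j : Fin N, {x | ⟪x, u j⟫ ≤ suppFn K (u j)})
    (hfacet : ∀ j : Fin N,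
      μH[(n : ℝ) - 1] (K ∩ {x | ⟪x, u j⟫ = suppFn K (u j)}) ≠ 0) (i : Fin N) :
    ∃ δ : ℝ, 0 < δ ∧ ∀ r : ℕ, r ≤ n - 1 → ∀ t : ℝ, |t| < δ →
      ∀ μ ν : Measure (Metric.sphere (0 : EuclideanSpace ℝ (Fin n)) 1),
        IsMixedAreaMeasure n r (movedPoly K u i t) K μ →
        IsMixedAreaMeasure n 0 K K ν →
        msupport μ = msupport ν := by
  rcases hn.eq_or_lt with rfl | hn2
  · exact ⟨1, one_pos, fun r _ t _ μ ν hμ hν => msupport_eq_of_dim_one hμ hν⟩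
  by_cases hex : ∃ ν : Measure (Metric.sphere (0 : EuclideanSpace ℝ (Fin n)) 1),
      IsMixedAreaMeasure n 0 K K ν
  swap
  · exact ⟨1, one_pos, fun r _ t _ μ ν _ hν => absurd ⟨ν, hν⟩ hex⟩
  obtain ⟨ν₀, hν₀⟩ := hex
  have hev := eventually_weights_pos (i := i) hn2 hK hKdim hu huinj hKrep hfacet hν₀
  obtain ⟨δ, hδ, h⟩ := Metric.eventually_nhds_iff.1 hev
  refine ⟨δ, hδ, fun r hr t ht μ ν hμ hν => ?_⟩
  obtain ⟨c, hc, hcV⟩ := h (by simpa using ht) r (by omega) μ hμ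
  have hν1 : IsMixedAreaMeasure n 0 (movedPoly K u i 0) K ν := by
    rwa [movedPoly_zero hKrep]
  obtain ⟨c', hc', hcV'⟩ := h (y := 0) (by simpa using hδ) 0 (by omega) ν hν1
  have hV := IsMixedAreaMeasure.eq_headFamily hKrep hμ
  have hV' := IsMixedAreaMeasure.eq_headFamily hKrep hν1
  refine msupport_eq_of_representing (by omega)
    (V := fun L => mixedVol n (headFamily L (movedFamily K u i r t)))
    (V' := fun L => mixedVol n (headFamily L (movedFamily K u i 0 0))) hV hV'
    (unitBall_ne_zero i hu hc hcV (mixedVol_smul_of_forall hV))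
    (unitBall_ne_zero i hu hc' hcV' (mixedVol_smul_of_forall hV')) fun w ε hε => ?_
  rw [eq_truncatedBall_iff hu hc hcV hε, eq_truncatedBall_iff hu hc' hcV' hε]

end Main

end MovedFacet

/-- For an `n`-polytope `K` with facet normals `u 1, …, u N`, moving one fixed facet by a
sufficiently small `t` does not change the support of the mixed area measures
`S(K_t[r],K[n-1-r],·)`: they all coincide with the support of the surface area
measure `S(K,·)`. -/
theorem support_of_mixed_area_measure_of_moved_facet (n N : ℕ) (hn : 1 ≤ n)
    (K : Set (EuclideanSpace ℝ (Fin n))) (hK : IsConvexBody K)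
    (hKdim : (interior K).Nonempty)
    (hKpoly : ∃ s : Finset (EuclideanSpace ℝ (Fin n)), K = convexHull ℝ (s : Set _))
    (u : Fin N → EuclideanSpace ℝ (Fin n)) (hu : ∀ j, ‖u j‖ = 1)
    (huinj : Function.Injective u)
    (hKrep : K = ⋂ j : Fin N, {x | ⟪x, u j⟫ ≤ suppFn K (u j)})
    (hfacet : ∀ j : Fin N,
      μH[(n : ℝ) - 1] (K ∩ {x | ⟪x, u j⟫ = suppFn K (u j)}) ≠ 0)
    (i : Fin N) :
    ∃ δ : ℝ, 0 < δ ∧ ∀ r : ℕ, r ≤ n - 1 → ∀ t : ℝ, |t| < δ →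
      ∀ μ ν : Measure (Metric.sphere (0 : EuclideanSpace ℝ (Fin n)) 1),
        IsMixedAreaMeasure n r (movedPoly K u i t) K μ →
        IsMixedAreaMeasure n 0 K K ν →
        msupport μ = msupport ν := by
  exact MovedFacet.exists_msupport_eq hn hK hKdim hu huinj hKrep hfacet i
end

section
/- Let K = {x ∈ ℝ³ : x₃ ≤ 1} ∩ conv({(0,x₂,x₃) : x₃ = x₂²} ∪ {(x₁,0,x₃) : x₃ = x₁²}). Then the origin is a strict point of ∂K, but no neighborhood of the origin in ∂K is free of line segments; i.e., every neighborhood of the origin in ∂K contains a line segment. -/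
open Pointwise

/-- A boundary point `x` of `K` is a strict point if it does not belong to any
(nondegenerate) line segment contained in the boundary of `K`. -/
def IsStrictPoint (K : Set (EuclideanSpace ℝ (Fin 3)))
    (x : EuclideanSpace ℝ (Fin 3)) : Prop :=
  x ∈ frontier K ∧
    ∀ a b : EuclideanSpace ℝ (Fin 3), segment ℝ a b ⊆ frontier K → x ∈ segment ℝ a b → a = b

theorem convex_l1_sq_epigraph :
    Convex ℝ {x : EuclideanSpace ℝ (Fin 3) | (|x 0| + |x 1|) ^ 2 ≤ x 2} := by
  intro x hx y hy s t hs ht hst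
  simp only [Set.mem_ofPred_eq, PiLp.add_apply, PiLp.smul_apply, smul_eq_mul] at hx hy ⊢
  have h0 : |s * x 0 + t * y 0| ≤ s * |x 0| + t * |y 0| := by
    refine (abs_add_le _ _).trans_eq ?_
    rw [abs_mul, abs_mul, abs_of_nonneg hs, abs_of_nonneg ht]
  have h1 : |s * x 1 + t * y 1| ≤ s * |x 1| + t * |y 1| := by
    refine (abs_add_le _ _).trans_eq ?_
    rw [abs_mul, abs_mul, abs_of_nonneg hs, abs_of_nonneg ht]
  calc (|s * x 0 + t * y 0| + |s * x 1 + t * y 1|) ^ 2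
      ≤ (s * (|x 0| + |x 1|) + t * (|y 0| + |y 1|)) ^ 2 := by
        exact pow_le_pow_left₀ (by positivity) (by linarith) 2
    _ ≤ s * (|x 0| + |x 1|) ^ 2 + t * (|y 0| + |y 1|) ^ 2 := by
        have := (convexOn_pow 2 (𝕜 := ℝ)).2 (x := |x 0| + |x 1|) (y := |y 0| + |y 1|)
          (by simp only [Set.mem_Ici]; positivity) (by simp only [Set.mem_Ici]; positivity)
          hs ht hst
        simpa using this
    _ ≤ s * x 2 + t * y 2 := by gcongr

theorem convexHull_parabolas_eq :
    convexHull ℝ ({x : EuclideanSpace ℝ (Fin 3) | x 0 = 0 ∧ x 2 = (x 1) ^ 2} ∪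
        {x : EuclideanSpace ℝ (Fin 3) | x 1 = 0 ∧ x 2 = (x 0) ^ 2}) =
      {x : EuclideanSpace ℝ (Fin 3) | (|x 0| + |x 1|) ^ 2 ≤ x 2} := by
  apply Set.Subset.antisymm
  · refine convexHull_min ?_ convex_l1_sq_epigraph
    rintro x (⟨h, h'⟩ | ⟨h, h'⟩) <;> simp [h, h']
  · intro p hp
    simp only [Set.mem_ofPred_eq] at hp
    set S := ({x : EuclideanSpace ℝ (Fin 3) | x 0 = 0 ∧ x 2 = (x 1) ^ 2} ∪
        {x : EuclideanSpace ℝ (Fin 3) | x 1 = 0 ∧ x 2 = (x 0) ^ 2}) with hS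
    have hz : 0 ≤ p 2 := (sq_nonneg _).trans hp
    obtain ⟨w, hw, hwz⟩ : ∃ w : ℝ, 0 ≤ w ∧ w ^ 2 = p 2 := ⟨√(p 2), by positivity, Real.sq_sqrt hz⟩
    have hu : |p 0| + |p 1| ≤ w := by
      rw [← hwz] at hp
      exact (sq_le_sq₀ (by positivity) hw).1 hp
    have hc := convex_convexHull ℝ S
    have hsub := subset_convexHull ℝ S
    rcases hw.eq_or_lt with rfl | hpos
    · have h0 : p 0 = 0 := abs_eq_zero.1 (by linarith [abs_nonneg (p 0), abs_nonneg (p 1)])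
      have h1 : p 1 = 0 := abs_eq_zero.1 (by linarith [abs_nonneg (p 0), abs_nonneg (p 1)])
      exact hsub (Or.inl ⟨h0, by rw [← hwz, h1]⟩)
    have hA : !₂[w, 0, w ^ 2] ∈ convexHull ℝ S := hsub (Or.inr (by simp))
    have hB : !₂[0, w, w ^ 2] ∈ convexHull ℝ S := hsub (Or.inl (by simp))
    have hC : !₂[-w, 0, w ^ 2] ∈ convexHull ℝ S := hsub (Or.inr (by simp))
    have hD : !₂[0, -w, w ^ 2] ∈ convexHull ℝ S := hsub (Or.inl (by simp))
    have key : ∀ r : ℝ, |r| ≤ w → 0 ≤ (1 + r / w) / 2 ∧ 0 ≤ 1 - (1 + r / w) / 2 := by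
      intro r hr
      have h1 : -1 ≤ r / w := by rw [le_div_iff₀ hpos]; linarith [(abs_le.1 hr).1]
      have h2 : r / w ≤ 1 := by rw [div_le_iff₀ hpos]; linarith [(abs_le.1 hr).2]
      constructor <;> linarith
    obtain ⟨hs, hs'⟩ := key (p 0 + p 1) ((abs_add_le _ _).trans hu)
    obtain ⟨ht, ht'⟩ := key (p 0 - p 1) ((abs_sub _ _).trans hu)
    have := hc (hc hA hB ht ht' (by ring)) (hc hD hC ht ht' (by ring)) hs hs' (by ring)
    convert this using 1
    ext i
    fin_cases i
    · simp
      field_simp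
      ring
    · simp
      field_simp
      ring
    · simp [← hwz]
      ring

theorem mem_frontier_of_eq_l1_sq {p : EuclideanSpace ℝ (Fin 3)}
    (h : (|p 0| + |p 1|) ^ 2 = p 2) (h1 : p 2 ≤ 1) :
    p ∈ frontier ({x : EuclideanSpace ℝ (Fin 3) | x 2 ≤ 1} ∩
      {x : EuclideanSpace ℝ (Fin 3) | (|x 0| + |x 1|) ^ 2 ≤ x 2}) := by
  refine ⟨subset_closure ⟨h1, h.le⟩, fun hint => ?_⟩
  have hcont : Continuous fun t : ℝ => p - t • !₂[(0 : ℝ), 0, 1] := by fun_prop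
  have hnhds : ∀ᶠ t : ℝ in nhds 0, p - t • !₂[(0 : ℝ), 0, 1] ∈
      ({x : EuclideanSpace ℝ (Fin 3) | x 2 ≤ 1} ∩
      {x : EuclideanSpace ℝ (Fin 3) | (|x 0| + |x 1|) ^ 2 ≤ x 2}) :=
    hcont.continuousAt.preimage_mem_nhds
      (by rw [zero_smul, sub_zero]; exact mem_interior_iff_mem_nhds.1 hint)
  obtain ⟨ε, hε, hball⟩ := Metric.eventually_nhds_iff.1 hnhds
  have := (hball (y := ε / 2) (by simp [abs_of_pos hε, hε])).2
  simp at this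
  linarith

theorem notMem_frontier_of_l1_sq_lt {p : EuclideanSpace ℝ (Fin 3)}
    (h : (|p 0| + |p 1|) ^ 2 < p 2) (h1 : p 2 < 1) :
    p ∉ frontier ({x : EuclideanSpace ℝ (Fin 3) | x 2 ≤ 1} ∩
      {x : EuclideanSpace ℝ (Fin 3) | (|x 0| + |x 1|) ^ 2 ≤ x 2}) := by
  refine fun hf => hf.2 (mem_interior.2 ⟨{x : EuclideanSpace ℝ (Fin 3) | x 2 < 1} ∩
      {x : EuclideanSpace ℝ (Fin 3) | (|x 0| + |x 1|) ^ 2 < x 2}, ?_, ?_, h1, h⟩)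
  · rintro x ⟨hx, hx'⟩
    simp only [Set.mem_ofPred_eq] at hx hx'
    exact ⟨hx.le, hx'.le⟩
  · exact (isOpen_lt (by fun_prop) (by fun_prop)).inter (isOpen_lt (by fun_prop) (by fun_prop))

theorem isClosed_truncated_l1_sq_epigraph :
    IsClosed ({x : EuclideanSpace ℝ (Fin 3) | x 2 ≤ 1} ∩
      {x : EuclideanSpace ℝ (Fin 3) | (|x 0| + |x 1|) ^ 2 ≤ x 2}) :=
  (isClosed_le (by fun_prop) (by fun_prop)).inter (isClosed_le (by fun_prop) (by fun_prop))

theorem eq_zero_of_l1_sq_le_of_nonpos {x : EuclideanSpace ℝ (Fin 3)}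
    (h : (|x 0| + |x 1|) ^ 2 ≤ x 2) (h2 : x 2 ≤ 0) : x = 0 := by
  have hz : x 2 = 0 := le_antisymm h2 ((sq_nonneg _).trans h)
  have hs : |x 0| + |x 1| = 0 := pow_eq_zero_iff two_ne_zero |>.1
    (le_antisymm (h.trans h2) (sq_nonneg _))
  have h0 : x 0 = 0 := abs_eq_zero.1 (by linarith [abs_nonneg (x 0), abs_nonneg (x 1)])
  have h1 : x 1 = 0 := abs_eq_zero.1 (by linarith [abs_nonneg (x 0), abs_nonneg (x 1)])
  ext i
  fin_cases i
  · exact h0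
  · exact h1
  · exact hz

theorem eq_zero_of_segment_zero_subset_frontier {b : EuclideanSpace ℝ (Fin 3)}
    (h : segment ℝ 0 b ⊆ frontier ({x : EuclideanSpace ℝ (Fin 3) | x 2 ≤ 1} ∩
      {x : EuclideanSpace ℝ (Fin 3) | (|x 0| + |x 1|) ^ 2 ≤ x 2})) : b = 0 := by
  obtain ⟨hb1, hb⟩ :=
    isClosed_truncated_l1_sq_epigraph.frontier_subset (h (right_mem_segment ℝ 0 b))
  simp only [Set.mem_ofPred_eq] at hb1 hb
  by_contra hne
  have hpos : 0 < b 2 := by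
    by_contra! hle
    exact hne (eq_zero_of_l1_sq_le_of_nonpos hb hle)
  have hmid : (1 / 2 : ℝ) • b ∈ segment ℝ 0 b :=
    ⟨1 / 2, 1 / 2, by norm_num, by norm_num, by norm_num, by simp⟩
  refine notMem_frontier_of_l1_sq_lt ?_ ?_ (h hmid)
  · simp only [PiLp.smul_apply, smul_eq_mul, abs_mul]
    rw [abs_of_pos (by norm_num : (0 : ℝ) < 1 / 2)]
    nlinarith
  · simp only [PiLp.smul_apply, smul_eq_mul]
    linarith

/-- For `K = {x₃ ≤ 1} ∩ conv({(0,x₂,x₂²)} ∪ {(x₁,0,x₁²)})` in `ℝ³`, the origin is a strict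
point of `∂K`, yet every neighborhood of the origin contains a (nondegenerate) line segment
lying in `∂K`: `K` is not strictly convex in any neighborhood of the origin. -/
theorem strict_point_not_locally_strictly_convex
    (K : Set (EuclideanSpace ℝ (Fin 3)))
    (hKdef : K = {x : EuclideanSpace ℝ (Fin 3) | x 2 ≤ 1} ∩
      convexHull ℝ ({x : EuclideanSpace ℝ (Fin 3) | x 0 = 0 ∧ x 2 = (x 1) ^ 2} ∪
        {x : EuclideanSpace ℝ (Fin 3) | x 1 = 0 ∧ x 2 = (x 0) ^ 2})) :
    IsStrictPoint K 0 ∧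
      ∀ U : Set (EuclideanSpace ℝ (Fin 3)), U ∈ nhds (0 : EuclideanSpace ℝ (Fin 3)) →
        ∃ a b : EuclideanSpace ℝ (Fin 3), a ≠ b ∧
          segment ℝ a b ⊆ frontier K ∧ segment ℝ a b ⊆ U := by
  rw [convexHull_parabolas_eq] at hKdef
  subst hKdef
  refine ⟨⟨mem_frontier_of_eq_l1_sq (by simp) (by simp), ?_⟩, ?_⟩
  · rintro a b hab hmem
    obtain ⟨s, t, hs, ht, hst, h0⟩ := hmem
    have ha := (isClosed_truncated_l1_sq_epigraph.frontier_subset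
      (hab (left_mem_segment ℝ a b))).2
    have hb := (isClosed_truncated_l1_sq_epigraph.frontier_subset
      (hab (right_mem_segment ℝ a b))).2
    simp only [Set.mem_ofPred_eq] at ha hb
    have ha2 : 0 ≤ a 2 := (sq_nonneg _).trans ha
    have hb2 : 0 ≤ b 2 := (sq_nonneg _).trans hb
    have hz : s * a 2 + t * b 2 = 0 := by simpa using congrArg (fun x => x 2) h0
    have hsa : s * a 2 = 0 := by nlinarith [mul_nonneg hs ha2, mul_nonneg ht hb2]
    rcases mul_eq_zero.1 hsa with rfl | ha0
    · obtain rfl : t = 1 := by linarith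
      have hb0 : b = 0 := eq_zero_of_l1_sq_le_of_nonpos hb (by linarith)
      subst hb0
      rw [segment_symm] at hab
      exact eq_zero_of_segment_zero_subset_frontier hab
    · have ha0' : a = 0 := eq_zero_of_l1_sq_le_of_nonpos ha ha0.le
      subst ha0'
      exact (eq_zero_of_segment_zero_subset_frontier hab).symm
  · intro U hU
    obtain ⟨ε, hε, hball⟩ := Metric.mem_nhds_iff.1 hU
    have hzero : !₂[(0 : ℝ), 0, 0] = (0 : EuclideanSpace ℝ (Fin 3)) := by
      ext i
      fin_cases i <;> rfl
    have hball_nhds := Metric.ball_mem_nhds (0 : EuclideanSpace ℝ (Fin 3)) hε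
    have hA : ∀ᶠ c : ℝ in nhds 0, !₂[c, 0, c ^ 2] ∈
        Metric.ball (0 : EuclideanSpace ℝ (Fin 3)) ε :=
      (show Continuous fun c : ℝ => !₂[c, 0, c ^ 2] by fun_prop).continuousAt.preimage_mem_nhds
        (by rw [zero_pow two_ne_zero, hzero]; exact hball_nhds)
    have hB : ∀ᶠ c : ℝ in nhds 0, !₂[0, c, c ^ 2] ∈
        Metric.ball (0 : EuclideanSpace ℝ (Fin 3)) ε :=
      (show Continuous fun c : ℝ => !₂[0, c, c ^ 2] by fun_prop).continuousAt.preimage_mem_nhds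
        (by rw [zero_pow two_ne_zero, hzero]; exact hball_nhds)
    obtain ⟨δ, hδ, hAB⟩ := Metric.eventually_nhds_iff.1 (hA.and hB)
    obtain ⟨c, hc, hcm⟩ := exists_between (lt_min hδ one_pos)
    obtain ⟨hcδ, hc1⟩ := lt_min_iff.1 hcm
    obtain ⟨ha, hb⟩ := hAB (y := c) (by simpa [abs_of_pos hc] using hcδ)
    refine ⟨_, _, ?_, ?_, ((convex_ball 0 ε).segment_subset ha hb).trans hball⟩
    · intro h
      have : c = 0 := by simpa using congrArg (fun x => x 0) h
      exact hc.ne' this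
    · rintro _ ⟨s, t, hs, ht, hst, rfl⟩
      have hz : s * c ^ 2 + t * c ^ 2 = c ^ 2 := by rw [← add_mul, hst, one_mul]
      apply mem_frontier_of_eq_l1_sq
      · simp [hz, abs_of_nonneg, hs, ht, hc.le, ← add_mul, hst]
      · simpa [hz, abs_of_pos hc] using hc1.le
end
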